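/- For every integer m ≥ 1 and every nonzero homogeneous polynomial F ∈ ℝ[x,y,z,w] of degree d that vanishes to order at least m at each of the 60 points of the H4 configuration, one has 5d ≥ 18m. -/

import Mathlib

open MvPolynomial

/-- A polynomial `F ∈ ℝ[x,y,z,w]` vanishes to order at least `m` at a point with
representative vector `v` if all partial derivatives of `F` of total order less
than `m` vanish at `v`. -/
def vanishesToOrderR (F : MvPolynomial (Fin 4) ℝ) (v : Fin 4 → ℝ) (m : ℕ) : Prop :=
  ∀ l : List (Fin 4), l.length < m →
    eval v (l.foldl (fun G i => pderiv i G) F) = 0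

/-- The least degree of a nonzero homogeneous polynomial vanishing to order at least `m`
at every point of the configuration `Z`. -/
noncomputable def alphaSymbolicR (Z : Set (Fin 4 → ℝ)) (m : ℕ) : ℕ :=
  sInf { d | ∃ F : MvPolynomial (Fin 4) ℝ, F ≠ 0 ∧ F.IsHomogeneous d ∧
    ∀ v ∈ Z, vanishesToOrderR F v m }

/-- The golden ratio. -/
noncomputable def gr : ℝ := (1 + Real.sqrt 5) / 2

/-- The H4 configuration: 60 points of `ℙ³` consisting of the 4 coordinate points, the
8 points `(1:±1:±1:±1)`, and the 48 points whose coordinate vectors are the even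
permutations of `(φ, ±1, ±φ⁻¹, 0)`, where `φ` is the golden ratio. -/
noncomputable def H4Config : Set (Fin 4 → ℝ) :=
  { v | ∃ i : Fin 4, v = Pi.single i 1 } ∪
  { v | v 0 = 1 ∧ ∀ i : Fin 4, i ≠ 0 → (v i = 1 ∨ v i = -1) } ∪
  { v | ∃ σ : Equiv.Perm (Fin 4), Equiv.Perm.sign σ = 1 ∧
      ∃ ε₁ ε₂ : ℝ, (ε₁ = 1 ∨ ε₁ = -1) ∧ (ε₂ = 1 ∨ ε₂ = -1) ∧
        v = fun i => ![gr, ε₁, ε₂ * gr⁻¹, 0] (σ i) }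

/-- grading homomorphism -/
noncomputable def dlt {σ : Type*} (w : σ → ℕ) :
    MvPolynomial σ ℝ →ₐ[ℝ] Polynomial (MvPolynomial σ ℝ) :=
  aeval (fun i => Polynomial.X ^ (w i) * Polynomial.C (X i))

lemma dlt_monomial {σ : Type*} (w : σ → ℕ) (n : σ →₀ ℕ) (c : ℝ) :
    dlt w (monomial n c) = Polynomial.X ^ (Finsupp.weight w n) * Polynomial.C (monomial n c) := by
  rw [dlt, aeval_monomial, monomial_eq (s := n)]
  simp only [mul_pow, map_mul, Finsupp.weight_apply, Finsupp.sum, Finsupp.prod,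
    smul_eq_mul, ← pow_mul, map_prod, map_pow, Finset.prod_mul_distrib, Finset.prod_pow_eq_pow_sum]
  rw [show (algebraMap ℝ (Polynomial (MvPolynomial σ ℝ))) c = Polynomial.C (C c) from rfl]
  simp only [mul_comm (w _)]
  ring

lemma coeff_dlt {σ : Type*} (w : σ → ℕ) (P : MvPolynomial σ ℝ) (k : ℕ) (n : σ →₀ ℕ) :
    coeff n ((dlt w P).coeff k) = if Finsupp.weight w n = k then coeff n P else 0 := by
  induction P using MvPolynomial.induction_on' with
  | monomial u a =>
    classical
    rw [dlt_monomial, Polynomial.X_pow_mul, Polynomial.coeff_C_mul_X_pow]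
    split_ifs with h1 h2 h2
    · rfl
    · rw [coeff_monomial, if_neg]
      rintro rfl; exact h2 h1.symm
    · rw [coeff_zero, coeff_monomial, if_neg]
      rintro rfl; exact h1 h2.symm
    · rfl
  | add p q hp hq =>
    rw [map_add, Polynomial.coeff_add, coeff_add, hp, hq, coeff_add]
    split_ifs <;> simp

lemma X_pow_dvd_dlt_iff {σ : Type*} (w : σ → ℕ) (P : MvPolynomial σ ℝ) (M : ℕ) :
    Polynomial.X ^ M ∣ dlt w P ↔ ∀ n ∈ P.support, M ≤ Finsupp.weight w n := by
  rw [Polynomial.X_pow_dvd_iff]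
  constructor
  · intro h n hn
    by_contra hlt
    have := h _ (not_le.mp hlt)
    have h2 := coeff_dlt w P (Finsupp.weight w n) n
    rw [this, if_pos rfl, coeff_zero] at h2
    exact (mem_support_iff.mp hn) h2.symm
  · intro h d hd
    ext n
    rw [coeff_dlt, coeff_zero]
    split_ifs with h1
    · by_contra h2
      have := h n (mem_support_iff.mpr h2)
      omega
    · rfl

lemma natDegree_dlt_le_iff {σ : Type*} (w : σ → ℕ) (P : MvPolynomial σ ℝ) (D : ℕ) :
    (dlt w P).natDegree ≤ D ↔ ∀ n ∈ P.support, Finsupp.weight w n ≤ D := by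
  rw [Polynomial.natDegree_le_iff_coeff_eq_zero]
  constructor
  · intro h n hn
    by_contra hlt
    have := h _ (not_le.mp hlt)
    have h2 := coeff_dlt w P (Finsupp.weight w n) n
    rw [this, if_pos rfl, coeff_zero] at h2
    exact (mem_support_iff.mp hn) h2.symm
  · intro h d hd
    ext n
    rw [coeff_dlt, coeff_zero]
    split_ifs with h1
    · by_contra h2
      have := h n (mem_support_iff.mpr h2)
      omega
    · rfl

lemma dlt_ne_zero {σ : Type*} (w : σ → ℕ) {P : MvPolynomial σ ℝ} (hP : P ≠ 0) : dlt w P ≠ 0 := by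
  obtain ⟨n, hn⟩ := ne_zero_iff.mp hP
  intro h
  have h2 := coeff_dlt w P (Finsupp.weight w n) n
  rw [h, if_pos rfl, Polynomial.coeff_zero, coeff_zero] at h2
  exact hn h2.symm

lemma wdeg_of_mul {σ : Type*} (w : σ → ℕ) {P Q : MvPolynomial σ ℝ} (hQ : Q ≠ 0) {D r : ℕ}
    (h : ∀ n ∈ (P * Q).support, Finsupp.weight w n ≤ D)
    {u : σ →₀ ℕ} (hu : coeff u P ≠ 0) (hr : Finsupp.weight w u = r) :
    r ≤ D ∧ ∀ n ∈ Q.support, Finsupp.weight w n ≤ D - r := by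
  have hP : P ≠ 0 := fun h0 => hu (by rw [h0, coeff_zero])
  have h1 := (natDegree_dlt_le_iff w (P * Q) D).mpr h
  rw [map_mul, Polynomial.natDegree_mul (dlt_ne_zero w hP) (dlt_ne_zero w hQ)] at h1
  have h2 := (natDegree_dlt_le_iff w P _).mp le_rfl u (mem_support_iff.mpr hu)
  refine ⟨by omega, (natDegree_dlt_le_iff w Q _).mp (by omega)⟩

lemma word_of_mul {σ : Type*} (w : σ → ℕ) {P Q : MvPolynomial σ ℝ} {M r : ℕ}
    (h : ∀ n ∈ (P * Q).support, M ≤ Finsupp.weight w n)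
    {u : σ →₀ ℕ} (hu : coeff u P ≠ 0) (hr : Finsupp.weight w u = r) :
    ∀ n ∈ Q.support, M - r ≤ Finsupp.weight w n := by
  have hP : P ≠ 0 := fun h0 => hu (by rw [h0, coeff_zero])
  have h1 := (X_pow_dvd_dlt_iff w (P * Q) M).mpr h
  rw [map_mul] at h1
  rw [← X_pow_dvd_dlt_iff]
  by_cases hM : M ≤ r
  · rw [Nat.sub_eq_zero_of_le hM]; simp
  have h2 : ¬ Polynomial.X ^ (r + 1) ∣ dlt w P := by
    rw [X_pow_dvd_dlt_iff]
    intro h3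
    have := h3 u (mem_support_iff.mpr hu)
    omega
  have hX : Prime (Polynomial.X : Polynomial (MvPolynomial σ ℝ)) := Polynomial.prime_X
  rw [pow_dvd_iff_le_emultiplicity] at h1 ⊢
  rw [emultiplicity_mul hX] at h1
  rw [pow_dvd_iff_le_emultiplicity, not_le] at h2
  have h3 : emultiplicity Polynomial.X (dlt w P) ≤ (r : ℕ∞) := by
    exact Order.le_of_lt_add_one (by exact_mod_cast h2)
  rw [ENat.natCast_sub]
  rw [tsub_le_iff_left]
  exact h1.trans (by gcongr)

lemma weight_two (w : Fin 2 → ℕ) (n : Fin 2 →₀ ℕ) :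
    Finsupp.weight w n = w 0 * n 0 + w 1 * n 1 := by
  rw [Finsupp.weight_apply, Finsupp.sum_fintype _ _ (by simp)]
  simp [Fin.sum_univ_two, mul_comm]

lemma weight_three (w : Fin 3 → ℕ) (n : Fin 3 →₀ ℕ) :
    Finsupp.weight w n = w 0 * n 0 + w 1 * n 1 + w 2 * n 2 := by
  rw [Finsupp.weight_apply, Finsupp.sum_fintype _ _ (by simp)]
  simp [Fin.sum_univ_three, mul_comm]

noncomputable def tau2 : MvPolynomial (Fin 2) ℝ →ₐ[ℝ] MvPolynomial (Fin 2) ℝ :=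
  aeval ![1 + X 0, 1 + C (3/2) * X 0 + X 1]

noncomputable def pA : MvPolynomial (Fin 2) ℝ := X 1 - C (3/2) * X 0 + C (1/2)
noncomputable def pC : MvPolynomial (Fin 2) ℝ := X 1 ^ 2 - X 0 ^ 3

lemma aeval_two_sum {S : Type*} [CommRing S] [Algebra ℝ S] (f : Fin 2 → S)
    (P : MvPolynomial (Fin 2) ℝ) :
    aeval f P = ∑ n ∈ P.support, algebraMap ℝ S (coeff n P) * (f 0 ^ n 0 * f 1 ^ n 1) := by
  rw [aeval_def, eval₂_eq']
  simp [Fin.prod_univ_two]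

lemma divA (P : MvPolynomial (Fin 2) ℝ) : ∃ (Q : MvPolynomial (Fin 2) ℝ) (R : Polynomial ℝ),
    P = pA * Q + Polynomial.aeval (X 0 : MvPolynomial (Fin 2) ℝ) R := by
  induction P using MvPolynomial.induction_on with
  | C a => exact ⟨0, Polynomial.C a, by simp [algebraMap_eq]⟩
  | add p q hp hq =>
    obtain ⟨Q, R, h⟩ := hp
    obtain ⟨Q', R', h'⟩ := hq
    refine ⟨Q + Q', R + R', ?_⟩
    rw [h, h', map_add]; ring
  | mul_X p i hp =>
    obtain ⟨Q, R, h⟩ := hp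
    fin_cases i
    · refine ⟨Q * X 0, R * Polynomial.X, ?_⟩
      simp only [Fin.zero_eta, map_mul, Polynomial.aeval_X]
      conv_lhs => rw [h]
      ring
    · refine ⟨Q * X 1 + Polynomial.aeval (X 0 : MvPolynomial (Fin 2) ℝ) R,
        R * (Polynomial.C (3/2) * Polynomial.X - Polynomial.C (1/2)), ?_⟩
      simp only [Fin.mk_one, map_mul, map_sub, Polynomial.aeval_X, Polynomial.aeval_C,
        algebraMap_eq]
      conv_lhs => rw [h]
      rw [pA]; ring

lemma divC (P : MvPolynomial (Fin 2) ℝ) : ∃ (Q : MvPolynomial (Fin 2) ℝ) (R S : Polynomial ℝ),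
    P = pC * Q + Polynomial.aeval (X 0 : MvPolynomial (Fin 2) ℝ) R
      + X 1 * Polynomial.aeval (X 0 : MvPolynomial (Fin 2) ℝ) S := by
  induction P using MvPolynomial.induction_on with
  | C a => exact ⟨0, Polynomial.C a, 0, by simp [algebraMap_eq]⟩
  | add p q hp hq =>
    obtain ⟨Q, R, S, h⟩ := hp
    obtain ⟨Q', R', S', h'⟩ := hq
    refine ⟨Q + Q', R + R', S + S', ?_⟩
    rw [h, h', map_add, map_add]; ring
  | mul_X p i hp =>
    obtain ⟨Q, R, S, h⟩ := hp
    fin_cases i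
    · refine ⟨Q * X 0, R * Polynomial.X, S * Polynomial.X, ?_⟩
      simp only [Fin.zero_eta, map_mul, Polynomial.aeval_X]
      conv_lhs => rw [h]
      ring
    · refine ⟨Q * X 1 + Polynomial.aeval (X 0 : MvPolynomial (Fin 2) ℝ) S,
        S * Polynomial.X ^ 3, R, ?_⟩
      simp only [Fin.mk_one, map_mul, map_pow, Polynomial.aeval_X]
      conv_lhs => rw [h]
      rw [pC]; ring

lemma pA_dvd {P : MvPolynomial (Fin 2) ℝ}
    (h : aeval ![Polynomial.X, Polynomial.C (3/2) * Polynomial.X - Polynomial.C (1/2)] P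
      = (0 : Polynomial ℝ)) : ∃ Q, P = pA * Q := by
  obtain ⟨Q, R, hP⟩ := divA P
  refine ⟨Q, ?_⟩
  have hR : R = 0 := by
    rw [hP, pA] at h
    rw [map_add, ← Polynomial.aeval_algHom_apply] at h
    simpa [← Polynomial.C_eq_algebraMap, algebraMap_eq] using h
  rw [hP, hR]; simp

lemma pC_dvd {P : MvPolynomial (Fin 2) ℝ}
    (h : aeval ![Polynomial.X ^ 2, Polynomial.X ^ 3] P
      = (0 : Polynomial ℝ)) : ∃ Q, P = pC * Q := by
  obtain ⟨Q, R, S, hP⟩ := divC P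
  refine ⟨Q, ?_⟩
  have h1 : Polynomial.expand ℝ 2 R + Polynomial.X ^ 3 * Polynomial.expand ℝ 2 S = 0 := by
    rw [hP, pC] at h
    rw [map_add, map_add, map_mul (aeval _) (X 1), ← Polynomial.aeval_algHom_apply,
      ← Polynomial.aeval_algHom_apply] at h
    rw [Polynomial.expand_eq_comp_X_pow, Polynomial.expand_eq_comp_X_pow, Polynomial.comp_eq_aeval,
      Polynomial.comp_eq_aeval]
    simp only [aeval_X, Matrix.cons_val_zero, Matrix.cons_val_one, map_mul, map_sub, map_pow] at h
    linear_combination h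
  have hR : R = 0 := by
    ext n
    have := congrArg (fun p => Polynomial.coeff p (n * 2)) h1
    simp only [Polynomial.coeff_add, Polynomial.coeff_expand_mul (p := 2) two_pos,
      Polynomial.coeff_X_pow_mul', Polynomial.coeff_zero] at this
    rw [Polynomial.coeff_zero, ← this]
    split_ifs with h3
    · rw [Polynomial.coeff_expand two_pos, if_neg (by omega), add_zero]
    · simp
  have hS : S = 0 := by
    rw [hR] at h1
    rw [map_zero, zero_add, mul_eq_zero, or_iff_right (pow_ne_zero _ Polynomial.X_ne_zero)] at h1
    exact (Polynomial.expand_eq_zero two_pos).mp h1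
  rw [hP, hR, hS]; simp

lemma pow_dvd_aeval_two (f : Fin 2 → Polynomial ℝ) (P : MvPolynomial (Fin 2) ℝ) (q : Polynomial ℝ)
    (w : Fin 2 → ℕ) (L : ℕ) (h0 : q ^ (w 0) ∣ f 0) (h1 : q ^ (w 1) ∣ f 1)
    (h : ∀ n ∈ P.support, L ≤ Finsupp.weight w n) : q ^ L ∣ aeval f P := by
  rw [aeval_two_sum]
  refine Finset.dvd_sum fun n hn => Dvd.dvd.mul_left ?_ _
  have := h n hn
  rw [weight_two] at this
  refine (pow_dvd_pow q this).trans ?_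
  rw [pow_add, pow_mul, pow_mul]
  exact mul_dvd_mul (pow_dvd_pow_of_dvd h0 _) (pow_dvd_pow_of_dvd h1 _)

lemma natDegree_aeval_two (f : Fin 2 → Polynomial ℝ) (P : MvPolynomial (Fin 2) ℝ)
    (a b e : ℕ) (h0 : (f 0).natDegree ≤ a) (h1 : (f 1).natDegree ≤ b)
    (h : ∀ n ∈ P.support, a * n 0 + b * n 1 ≤ e) : (aeval f P).natDegree ≤ e := by
  rw [aeval_two_sum]
  refine Polynomial.natDegree_sum_le_of_forall_le _ _ fun n hn => ?_
  have := h n hn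
  refine (Polynomial.natDegree_C_mul_le _ _).trans ?_
  refine Polynomial.natDegree_mul_le.trans ?_
  have e0 := Polynomial.natDegree_pow_le (p := f 0) (n := n 0)
  have e1 := Polynomial.natDegree_pow_le (p := f 1) (n := n 1)
  have e2 : n 0 * (f 0).natDegree ≤ n 0 * a := Nat.mul_le_mul_left _ h0
  have e3 : n 1 * (f 1).natDegree ≤ n 1 * b := Nat.mul_le_mul_left _ h1
  nlinarith

open Finsupp in
lemma end2 (e : ℕ) : ∀ (N L : ℕ) (P : MvPolynomial (Fin 2) ℝ), P ≠ 0 →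
    (∀ n ∈ P.support, weight ![2, 3] n ≤ e) →
    (∀ n ∈ P.support, N ≤ weight ![2, 3] n) →
    (∀ n ∈ (tau2 P).support, L ≤ weight ![1, 2] n) → 18 * L + 5 * N ≤ 12 * e := by
  induction e using Nat.strong_induction_on with
  | _ e ih =>
  intro N L P hP hdeg hN hL
  by_cases hA : aeval ![Polynomial.X, Polynomial.C (3/2) * Polynomial.X - Polynomial.C (1/2)] P
      = (0 : Polynomial ℝ)
  · obtain ⟨Q, rfl⟩ := pA_dvd hA
    have hQ : Q ≠ 0 := right_ne_zero_of_mul hP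
    obtain ⟨g1, g2⟩ := wdeg_of_mul ![2, 3] hQ hdeg (u := single 1 1) (r := 3)
      (by
        have h1 : (0 : Fin 2 →₀ ℕ) ≠ single 1 1 := by
          intro h; simpa using DFunLike.congr_fun h 1
        have h2 : (single 0 1 : Fin 2 →₀ ℕ) ≠ single 1 1 := by
          intro h; simpa using DFunLike.congr_fun h 1
        simp [pA, coeff_X, coeff_C, h1, h2]) (by simp [weight_two])
    have g3 := word_of_mul ![2, 3] hN (u := 0) (r := 0)
      (by simp [pA, coeff_X, coeff_C]) (by simp)
    rw [map_mul] at hL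
    have g4 := word_of_mul ![1, 2] hL (u := single 1 1) (r := 2)
      (by
        have : tau2 pA = X 1 := by
          simp only [tau2, pA, map_add, map_sub, map_mul, aeval_X, aeval_C, algebraMap_eq,
            Matrix.cons_val_zero, Matrix.cons_val_one]
          have : (C (3/2) : MvPolynomial (Fin 2) ℝ) = C (1/2) + 1 := by
            rw [← C_1, ← C_add]; norm_num
          rw [this]; ring
        rw [this]; simp) (by simp [weight_two])
    have := ih (e - 3) (by omega) _ _ Q hQ g2 g3 g4
    omega
  by_cases hC : aeval ![Polynomial.X ^ 2, Polynomial.X ^ 3] P = (0 : Polynomial ℝ)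
  · obtain ⟨Q, rfl⟩ := pC_dvd hC
    have hQ : Q ≠ 0 := right_ne_zero_of_mul hP
    have hc : coeff (single 1 2) pC ≠ 0 := by
      simp [pC, coeff_X_pow, Finsupp.single_eq_single_iff]
    obtain ⟨g1, g2⟩ := wdeg_of_mul ![2, 3] hQ hdeg hc (r := 6) (by simp [weight_two])
    have g3 := word_of_mul ![2, 3] hN hc (r := 6) (by simp [weight_two])
    rw [map_mul] at hL
    have g4 := word_of_mul ![1, 2] hL (u := single 1 1) (r := 2)
      (by
        have : tau2 pC = X 1 * (C 2 + X 1) + X 0 * (C 3 * X 1 - C (3/4) * X 0 - X 0 ^ 2) := by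
          simp only [tau2, pC, map_sub, map_pow, aeval_X,
            Matrix.cons_val_zero, Matrix.cons_val_one]
          have h1 : (C (3/2) : MvPolynomial (Fin 2) ℝ) = 6 * C (1/4) := by
            rw [show (6 : MvPolynomial (Fin 2) ℝ) = C 6 from rfl, ← C_mul]; norm_num
          have h2 : (C (3/4) : MvPolynomial (Fin 2) ℝ) = 3 * C (1/4) := by
            rw [show (3 : MvPolynomial (Fin 2) ℝ) = C 3 from rfl, ← C_mul]; norm_num
          have h3 : (4 * C (1/4) : MvPolynomial (Fin 2) ℝ) = 1 := by
            rw [show (4 : MvPolynomial (Fin 2) ℝ) = C 4 from rfl, ← C_mul]; norm_num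
          rw [h1, h2, show (C 2 : MvPolynomial (Fin 2) ℝ) = 2 from rfl,
            show (C 3 : MvPolynomial (Fin 2) ℝ) = 3 from rfl]
          generalize (C (1/4) : MvPolynomial (Fin 2) ℝ) = q at h3
          linear_combination (3 * X 0 + 3 * X 0 * X 1 + 3 * 3 * q * X 0 ^ 2 + 3 * X 0 ^ 2) * h3
        rw [this, coeff_add, show (single 1 1 : Fin 2 →₀ ℕ) = 0 + single 1 1 by simp, 
          mul_comm (X 1), coeff_mul_X, coeff_X_mul']
        simp [coeff_X]) (by simp [weight_two])
    have := ih (e - 6) (by omega) _ _ Q hQ g2 g3 g4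
    omega
  simp only [weight_two, Matrix.cons_val_zero, Matrix.cons_val_one] at hdeg
  -- first curve
  have hX1 : (Polynomial.X - 1 : Polynomial ℝ) = Polynomial.X - Polynomial.C 1 := by simp
  have a1 : 2 * L ≤ e := by
    have d1 : (Polynomial.X - Polynomial.C 1 : Polynomial ℝ) ^ L ∣
        aeval ![(Polynomial.X - Polynomial.C 1 : Polynomial ℝ), 0] (tau2 P) := by
      apply pow_dvd_aeval_two _ _ _ ![1, 2] _ _ _ hL <;> simp
    have e1 : aeval ![(Polynomial.X - Polynomial.C 1 : Polynomial ℝ), 0] (tau2 P) =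
        aeval ![Polynomial.X, Polynomial.C (3/2) * Polynomial.X - Polynomial.C (1/2)] P := by
      rw [tau2, ← AlgHom.comp_apply]
      congr 1
      refine MvPolynomial.algHom_ext fun i => ?_
      fin_cases i
      · simp
      · have : (Polynomial.C (3/2) : Polynomial ℝ) = Polynomial.C (1/2) + 1 := by
          rw [← Polynomial.C_1, ← Polynomial.C_add]; norm_num
        simp [this, ← Polynomial.C_eq_algebraMap, -map_div₀]
        ring
    rw [e1] at d1
    have d2 := Polynomial.natDegree_le_of_dvd d1 hA
    rw [Polynomial.natDegree_pow, Polynomial.natDegree_X_sub_C, mul_one] at d2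
    have d3 := natDegree_aeval_two
      ![Polynomial.X, Polynomial.C (3/2) * Polynomial.X - Polynomial.C (1/2)] P 1 1 (e / 2)
      (by simp) (by simp only [Matrix.cons_val_one]; compute_degree)
      (fun n hn => by have := hdeg n hn; omega)
    omega
  have a2 : L + N ≤ e := by
    have d1 : (Polynomial.X - Polynomial.C 1 : Polynomial ℝ) ^ L ∣
        aeval ![(Polynomial.X ^ 2 - 1 : Polynomial ℝ), Polynomial.X ^ 3 - 1 - Polynomial.C (3/2) *
          (Polynomial.X ^ 2 - 1)] (tau2 P) := by
      apply pow_dvd_aeval_two _ _ _ ![1, 2] _ _ _ hL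
      · exact ⟨Polynomial.X + 1, by simp; ring⟩
      · refine ⟨Polynomial.X + Polynomial.C (1/2), ?_⟩
        have h1 : (Polynomial.C (3/2) : Polynomial ℝ) = Polynomial.C (1/2) + 1 := by
          rw [← Polynomial.C_1, ← Polynomial.C_add]; norm_num
        have h2 : (2 * Polynomial.C (1/2) : Polynomial ℝ) = 1 := by
          rw [show (2 : Polynomial ℝ) = Polynomial.C 2 from rfl, ← Polynomial.C_mul]; norm_num
        simp only [h1, Matrix.cons_val_one, Matrix.cons_val_zero, Polynomial.C_1]
        generalize (Polynomial.C (1/2) : Polynomial ℝ) = q at h2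
        linear_combination (Polynomial.X - Polynomial.X ^ 2) * h2
    have e1 : aeval ![(Polynomial.X ^ 2 - 1 : Polynomial ℝ), Polynomial.X ^ 3 - 1 - Polynomial.C (3/2) *
          (Polynomial.X ^ 2 - 1)] (tau2 P) =
        aeval ![Polynomial.X ^ 2, Polynomial.X ^ 3] P := by
      rw [tau2, ← AlgHom.comp_apply]
      congr 1
      refine MvPolynomial.algHom_ext fun i => ?_
      fin_cases i
      · simp
      · simp [← Polynomial.C_eq_algebraMap, -map_div₀]
    rw [e1] at d1
    have d2 : (Polynomial.X : Polynomial ℝ) ^ N ∣ aeval ![Polynomial.X ^ 2, Polynomial.X ^ 3] P :=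
      pow_dvd_aeval_two _ _ _ ![2, 3] _ (by simp) (by simp) hN
    have cop : IsCoprime ((Polynomial.X - Polynomial.C 1 : Polynomial ℝ) ^ L)
        ((Polynomial.X : Polynomial ℝ) ^ N) := by
      apply IsCoprime.pow
      exact ⟨-1, 1, by simp⟩
    have d3 := Polynomial.natDegree_le_of_dvd (cop.mul_dvd d1 d2) hC
    rw [Polynomial.natDegree_mul (pow_ne_zero _ (Polynomial.X_sub_C_ne_zero 1))
      (pow_ne_zero _ Polynomial.X_ne_zero), Polynomial.natDegree_pow,
      Polynomial.natDegree_X_sub_C, Polynomial.natDegree_X_pow, mul_one] at d3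
    have d4 := natDegree_aeval_two ![Polynomial.X ^ 2, Polynomial.X ^ 3] P 2 3 e
      (by simp) (by simp) hdeg
    omega
  omega

noncomputable def tau3 : MvPolynomial (Fin 3) ℝ →ₐ[ℝ] MvPolynomial (Fin 3) ℝ :=
  aeval ![X 0, X 0 ^ 2 + X 1, X 2 + X 0 ^ 3 + C (3/2) * X 0 * X 1]

noncomputable def Del : MvPolynomial (Fin 3) ℝ →ₐ[ℝ] Polynomial (MvPolynomial (Fin 2) ℝ) :=
  aeval ![Polynomial.X, Polynomial.X ^ 2 * Polynomial.C (X 0),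
    Polynomial.X ^ 3 * Polynomial.C (X 1)]

noncomputable def tl (n : Fin 3 →₀ ℕ) : Fin 2 →₀ ℕ := Finsupp.equivFunOnFinite.symm ![n 1, n 2]

lemma Del_monomial (n : Fin 3 →₀ ℕ) (c : ℝ) : Del (monomial n c) =
    Polynomial.X ^ (n 0 + 2 * n 1 + 3 * n 2) * Polynomial.C (monomial (tl n) c) := by
  rw [Del, aeval_monomial, monomial_eq (s := tl n), Finsupp.prod_fintype _ _ (by simp),
    Finsupp.prod_fintype _ _ (by simp)]
  simp only [Fin.prod_univ_three, Fin.prod_univ_two, Matrix.cons_val_zero, Matrix.cons_val_one,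
    Matrix.cons_val, tl, Finsupp.equivFunOnFinite_symm_apply_apply, map_mul, map_pow]
  rw [show (algebraMap ℝ (Polynomial (MvPolynomial (Fin 2) ℝ))) c = Polynomial.C (C c) from rfl]
  ring

lemma coeff_Del (P : MvPolynomial (Fin 3) ℝ) (n : Fin 3 →₀ ℕ) :
    coeff (tl n) ((Del P).coeff (n 0 + 2 * n 1 + 3 * n 2)) = coeff n P := by
  induction P using MvPolynomial.induction_on' with
  | monomial u a =>
    classical
    rw [Del_monomial, Polynomial.X_pow_mul, Polynomial.coeff_C_mul_X_pow]
    by_cases h : u = n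
    · subst h; simp
    · rw [coeff_monomial, if_neg h]
      split_ifs with h1
      · rw [coeff_monomial, if_neg]
        intro h2
        apply h
        have e0 := DFunLike.congr_fun h2 0
        have e1 := DFunLike.congr_fun h2 1
        simp only [tl, Finsupp.equivFunOnFinite_symm_apply_apply, Matrix.cons_val_zero,
          Matrix.cons_val_one] at e0 e1
        ext i
        fin_cases i
        · simp; omega
        · simpa using e0
        · simpa using e1
      · simp
  | add p q hp hq =>
    rw [map_add, Polynomial.coeff_add, coeff_add, hp, hq, coeff_add]

lemma supp_Del (P : MvPolynomial (Fin 3) ℝ) (e : ℕ) (m : Fin 2 →₀ ℕ)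
    (h : m ∈ ((Del P).coeff e).support) :
    ∃ n ∈ P.support, n 0 + 2 * n 1 + 3 * n 2 = e ∧ n 1 = m 0 ∧ n 2 = m 1 := by
  classical
  have hP := P.as_sum
  rw [mem_support_iff] at h
  rw [hP, map_sum, Polynomial.finsetSum_coeff, coeff_sum] at h
  obtain ⟨n, hn, h⟩ := Finset.exists_ne_zero_of_sum_ne_zero h
  refine ⟨n, hn, ?_⟩
  rw [Del_monomial, Polynomial.X_pow_mul, Polynomial.coeff_C_mul_X_pow] at h
  split_ifs at h with h1
  · rw [coeff_monomial] at h
    split_ifs at h with h2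
    · exact ⟨h1.symm, by simp [← h2, tl], by simp [← h2, tl]⟩
    · exact absurd rfl h
  · exact absurd (coeff_zero _) h

lemma Del_tau (P : MvPolynomial (Fin 3) ℝ) :
    Del (tau3 P) = Polynomial.map (tau2 : _ →+* _) (Del P) := by
  have : (Del.comp tau3) = (Polynomial.mapAlgHom tau2).comp Del := by
    refine MvPolynomial.algHom_ext fun i => ?_
    fin_cases i
    · simp [tau3, Del]
    · simp [tau3, Del, tau2]
      ring
    · simp [tau3, Del, tau2, -map_div₀]
      ring
  exact DFunLike.congr_fun this P

open Finsupp in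
lemma end3 (D M : ℕ) (P : MvPolynomial (Fin 3) ℝ) (hP : P ≠ 0)
    (hD : ∀ n ∈ P.support, 6 * n 0 + 10 * n 1 + 15 * n 2 ≤ D)
    (hM : ∀ n ∈ (tau3 P).support, M ≤ n 0 + 3 * n 1 + 5 * n 2) : 18 * M ≤ 5 * D := by
  obtain ⟨n, hn⟩ := ne_zero_iff.mp hP
  set e := n 0 + 2 * n 1 + 3 * n 2 with he
  have h1 : coeff (tl n) ((Del P).coeff e) ≠ 0 := by rw [he, coeff_Del]; exact hn
  have h0 : (Del P).coeff e ≠ 0 := fun h => h1 (by rw [h, coeff_zero])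
  have h2 := end2 e (6 * e - D) (M - e) _ h0
    (by
      intro m hm
      obtain ⟨k, hk, k1, k2, k3⟩ := supp_Del _ _ _ hm
      simp [weight_two]; omega)
    (by
      intro m hm
      obtain ⟨k, hk, k1, k2, k3⟩ := supp_Del _ _ _ hm
      have := hD k hk
      simp [weight_two]; omega)
    (by
      intro m hm
      have h3 : tau2 ((Del P).coeff e) = (Del (tau3 P)).coeff e := by
        rw [Del_tau, Polynomial.coeff_map]; rfl
      rw [h3] at hm
      obtain ⟨k, hk, k1, k2, k3⟩ := supp_Del _ _ _ hm
      have := hM k hk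
      simp [weight_two]; omega)
  have h4 := hD n (MvPolynomial.mem_support_iff.mpr hn)
  omega

lemma pderiv_aeval {σ τ : Type*} [Fintype σ] (f : σ → MvPolynomial τ ℝ) (Q : MvPolynomial σ ℝ)
    (j : τ) : pderiv j (aeval f Q) = ∑ i, aeval f (pderiv i Q) * pderiv j (f i) := by
  classical
  induction Q using MvPolynomial.induction_on with
  | C a => simp [algebraMap_eq]
  | add p q hp hq => simp only [map_add, hp, hq, add_mul, Finset.sum_add_distrib]
  | mul_X p i hp =>
    rw [map_mul, pderiv_mul, hp, aeval_X]
    simp only [pderiv_mul, map_add, map_mul, aeval_X, add_mul, Finset.sum_add_distrib, pderiv_X]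
    rw [Finset.sum_mul]
    congr 1
    · refine Finset.sum_congr rfl fun k _ => by ring
    · rw [Finset.sum_eq_single i]
      · simp
      · intro b _ hb
        simp [hb.symm]
      · simp

lemma eq_C_of_pderiv_eq_zero {σ : Type*} (Q : MvPolynomial σ ℝ) (h : ∀ i, pderiv i Q = 0) :
    Q = C (coeff 0 Q) := by
  classical
  ext n
  rw [coeff_C]
  split_ifs with h0
  · rw [h0]
  · obtain ⟨i, hi⟩ : ∃ i, n i ≠ 0 := by
      by_contra hc
      push Not at hc
      exact h0 (by ext i; simp [hc i])
    have h1 := congrArg (coeff (n - Finsupp.single i 1)) (h i)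
    rw [coeff_pderiv, coeff_zero] at h1
    have h2 : n - Finsupp.single i 1 + Finsupp.single i 1 = n := by
      ext k
      by_cases hk : k = i
      · subst hk; simp; omega
      · simp [Ne.symm hk]
    rw [h2] at h1
    rcases mul_eq_zero.mp h1 with h3 | h3
    · exact h3
    · exfalso
      have : (0 : ℝ) ≤ (((n - Finsupp.single i 1 : σ →₀ ℕ) i : ℕ) : ℝ) := Nat.cast_nonneg _
      linarith

lemma jac_indep {σ : Type*} [Fintype σ] [DecidableEq σ] (f : σ → MvPolynomial σ ℝ)
    (hdet : (Matrix.of fun j i => pderiv j (f i)).det ≠ 0) (N : ℕ) :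
    ∀ Q : MvPolynomial σ ℝ, Q.totalDegree ≤ N → aeval f Q = 0 → Q = 0 := by
  induction N with
  | zero =>
    intro Q hQ h
    have := (totalDegree_eq_zero_iff_eq_C).mp (Nat.le_zero.mp hQ)
    rw [this, aeval_C, algebraMap_eq] at h
    rw [this, h]
  | succ N ih =>
    intro Q hQ h
    have h1 : ∀ i, aeval f (pderiv i Q) = 0 := by
      have h2 : (Matrix.of fun j i => pderiv j (f i)).mulVec (fun i => aeval f (pderiv i Q)) = 0 := by
        ext1 j
        have := pderiv_aeval f Q j
        rw [h, map_zero] at this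
        rw [Matrix.mulVec, dotProduct, Pi.zero_apply, this]
        exact Finset.sum_congr rfl fun k _ => by simp [mul_comm]
      have h3 := Matrix.eq_zero_of_mulVec_eq_zero hdet h2
      exact fun i => congrFun h3 i
    have h4 : ∀ i, pderiv i Q = 0 := by
      intro i
      refine ih _ ?_ (h1 i)
      refine Finset.sup_le fun m hm => ?_
      rw [mem_support_iff, coeff_pderiv] at hm
      have h6 := le_totalDegree (mem_support_iff.mpr (left_ne_zero_of_mul hm))
      rw [Finsupp.sum_add_index' (by simp) (by simp), Finsupp.sum_single_index (by simp)] at h6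
      omega
    have h5 := eq_C_of_pderiv_eq_zero Q h4
    rw [h5, aeval_C, algebraMap_eq] at h
    rw [h5, h]

lemma local_order {R : Type*} [CommRing R] [IsDomain R] [Algebra ℝ R] (y b a : PowerSeries R)
    (hind : ∀ Q : MvPolynomial (Fin 3) ℝ, aeval ![PowerSeries.constantCoeff y,
      PowerSeries.constantCoeff b, PowerSeries.constantCoeff a] Q = 0 → Q = 0)
    (Q : MvPolynomial (Fin 3) ℝ) (m : ℕ)
    (h : PowerSeries.X ^ m ∣ aeval ![PowerSeries.X ^ 2 * y, PowerSeries.X ^ 6 * b,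
      PowerSeries.X ^ 10 * a] Q) :
    ∀ n ∈ Q.support, m ≤ 2 * (n 0 + 3 * n 1 + 5 * n 2) := by
  intro n hn
  have hQ : Q ≠ 0 := by rintro rfl; simp at hn
  obtain ⟨G, hG, hG0⟩ := Polynomial.exists_eq_pow_rootMultiplicity_mul_and_not_dvd
    (dlt ![1, 3, 5] Q) (dlt_ne_zero _ hQ) 0
  set μ := Polynomial.rootMultiplicity 0 (dlt ![1, 3, 5] Q)
  rw [Polynomial.C_0, sub_zero] at hG hG0
  have h1 : μ ≤ n 0 + 3 * n 1 + 5 * n 2 := by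
    have := (X_pow_dvd_dlt_iff ![1, 3, 5] Q μ).mp ⟨G, hG⟩ n hn
    simpa [weight_three] using this
  let ψ₀ : MvPolynomial (Fin 3) ℝ →ₐ[ℝ] PowerSeries R := aeval ![y, b, a]
  let ψ : Polynomial (MvPolynomial (Fin 3) ℝ) →+* PowerSeries R :=
    Polynomial.eval₂RingHom (ψ₀ : _ →+* _) (PowerSeries.X ^ 2)
  have h2 : ψ (dlt ![1, 3, 5] Q) = aeval ![PowerSeries.X ^ 2 * y, PowerSeries.X ^ 6 * b,
      PowerSeries.X ^ 10 * a] Q := by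
    rw [dlt, aeval_def, aeval_def, hom_eval₂]
    congr 1
    · ext r
      simp [ψ, ψ₀]
    · funext i
      fin_cases i
      · simp [ψ, ψ₀]; ring
      · simp [ψ, ψ₀, ← pow_mul]; ring
      · simp [ψ, ψ₀, ← pow_mul]; ring
  have h3 : PowerSeries.constantCoeff (ψ G) = aeval ![PowerSeries.constantCoeff y,
      PowerSeries.constantCoeff b, PowerSeries.constantCoeff a] (G.coeff 0) := by
    have e1 : PowerSeries.constantCoeff (ψ G) = PowerSeries.constantCoeff (ψ₀ (G.coeff 0)) := by
      conv_lhs => rw [← Polynomial.divX_mul_X_add G]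
      simp [ψ]
    rw [e1]
    simp only [ψ₀, aeval_def]
    rw [hom_eval₂]
    congr 1
    funext i
    fin_cases i <;> simp
  have h4 : PowerSeries.constantCoeff (ψ G) ≠ 0 := by
    intro h5
    rw [h3] at h5
    have := hind _ h5
    exact hG0 (Polynomial.X_dvd_iff.mpr this)
  by_contra hlt
  have h6 : m = 2 * μ + (m - 2 * μ - 1) + 1 := by omega
  rw [← h2, hG, map_mul, map_pow, h6, pow_succ, pow_add] at h
  have h7 : ψ Polynomial.X = PowerSeries.X ^ 2 := by simp [ψ]
  rw [h7, ← pow_mul, mul_assoc, mul_dvd_mul_iff_left (pow_ne_zero _ PowerSeries.X_ne_zero)] at h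
  have h8 : (PowerSeries.X : PowerSeries R) ∣ ψ G := (Dvd.intro_left _ rfl).trans h
  exact h4 (PowerSeries.X_dvd_iff.mp h8)

lemma dlt_eq_iff {σ : Type*} (w : σ → ℕ) (P : MvPolynomial σ ℝ) (n : ℕ) :
    dlt w P = Polynomial.X ^ n * Polynomial.C P ↔ IsWeightedHomogeneous w P n := by
  constructor
  · intro h u hu
    have h1 := coeff_dlt w P (Finsupp.weight w u) u
    rw [h, if_pos rfl, Polynomial.X_pow_mul, Polynomial.coeff_C_mul_X_pow] at h1
    split_ifs at h1 with h2
    · exact h2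
    · exact absurd h1.symm hu
  · intro h
    ext k u
    rw [coeff_dlt, Polynomial.X_pow_mul, Polynomial.coeff_C_mul_X_pow]
    by_cases hu : coeff u P = 0
    · split_ifs <;> simp [hu]
    · have := h hu
      rw [this]
      simp only [eq_comm (a := n)]
      split_ifs <;> simp

lemma wh_quot {σ : Type*} (w : σ → ℕ) {J f : MvPolynomial σ ℝ} {a b : ℕ}
    (hJ : IsWeightedHomogeneous w J a) (hJ0 : J ≠ 0) (hf : IsWeightedHomogeneous w (J * f) b)
    (hf0 : f ≠ 0) : a ≤ b ∧ IsWeightedHomogeneous w f (b - a) := by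
  rw [← dlt_eq_iff] at hJ hf
  rw [map_mul, hJ, Polynomial.C_mul] at hf
  have hC : (Polynomial.C J : Polynomial (MvPolynomial σ ℝ)) ≠ 0 := by simpa using hJ0
  have h1 : Polynomial.X ^ a * dlt w f = Polynomial.X ^ b * Polynomial.C f := by
    apply mul_left_cancel₀ hC
    linear_combination hf
  have hX : (Polynomial.X : Polynomial (MvPolynomial σ ℝ)) ≠ 0 := Polynomial.X_ne_zero
  by_cases hab : a ≤ b
  · refine ⟨hab, ?_⟩
    rw [← dlt_eq_iff]
    apply mul_left_cancel₀ (pow_ne_zero a hX)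
    rw [h1, ← mul_assoc, ← pow_add, Nat.add_sub_cancel' hab]
  · exfalso
    obtain ⟨c, rfl⟩ : ∃ c, a = b + (c + 1) := ⟨a - b - 1, by omega⟩
    rw [pow_add, mul_assoc] at h1
    have h2 := mul_left_cancel₀ (pow_ne_zero b hX) h1
    have h3 := congrArg (fun p => Polynomial.coeff p 0) h2
    simp [pow_succ'] at h3
    exact hf0 h3.symm

noncomputable def lf (p : Fin 4 → ℝ) : MvPolynomial (Fin 4) ℝ := ∑ j, C (p j) * X j

noncomputable def sg (p : Fin 4 → ℝ) : MvPolynomial (Fin 4) ℝ →ₐ[ℝ] MvPolynomial (Fin 4) ℝ :=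
  aeval fun i => X i - C (p i / 2) * lf p

noncomputable def pr (p : Fin 4 → ℝ) : MvPolynomial (Fin 4) ℝ →ₐ[ℝ] MvPolynomial (Fin 4) ℝ :=
  aeval fun i => X i - C (p i / 4) * lf p

lemma pr_lf {p : Fin 4 → ℝ} (hp : ∑ j, p j ^ 2 = 4) : pr p (lf p) = 0 := by
  have h1 : pr p (lf p) = lf p - C ((∑ j, p j ^ 2) / 4) * lf p := by
    conv_lhs => rw [lf]
    simp only [pr, map_sum, map_mul, aeval_X, aeval_C, algebraMap_eq, mul_sub,
      Finset.sum_sub_distrib]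
    rw [← lf, Finset.sum_div, map_sum, Finset.sum_mul]
    congr 1
    refine Finset.sum_congr rfl fun j _ => ?_
    rw [← mul_assoc, ← C_mul]
    congr 2
    ring
  rw [h1, hp]
  simp

lemma lf_dvd_of_pr {p : Fin 4 → ℝ} {G : MvPolynomial (Fin 4) ℝ} (h : pr p G = 0) : lf p ∣ G := by
  have h1 : ∀ G : MvPolynomial (Fin 4) ℝ, lf p ∣ G - pr p G := by
    intro G
    induction G using MvPolynomial.induction_on with
    | C a => simp [pr]
    | add a b ha hb =>
      rw [map_add, add_sub_add_comm]
      exact dvd_add ha hb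
    | mul_X a i ha =>
      rw [map_mul]
      have : a * X i - pr p a * pr p (X i) = (a - pr p a) * X i + lf p * (pr p a * C (p i / 4)) := by
        rw [show pr p (X i) = X i - C (p i / 4) * lf p by simp [pr]]
        ring
      rw [this]
      exact dvd_add (Dvd.dvd.mul_right ha _) (Dvd.intro _ rfl)
  have := h1 G
  rwa [h, sub_zero] at this

lemma lf_dvd_iff {p : Fin 4 → ℝ} (hp : ∑ j, p j ^ 2 = 4) (G : MvPolynomial (Fin 4) ℝ) :
    lf p ∣ G ↔ pr p G = 0 := by
  refine ⟨?_, lf_dvd_of_pr⟩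
  rintro ⟨H, rfl⟩
  rw [map_mul, pr_lf hp, zero_mul]

lemma pr_sg {p : Fin 4 → ℝ} (hp : ∑ j, p j ^ 2 = 4) (G : MvPolynomial (Fin 4) ℝ) :
    pr p (sg p G) = pr p G := by
  have : (pr p).comp (sg p) = pr p := by
    refine MvPolynomial.algHom_ext fun i => ?_
    rw [AlgHom.comp_apply, sg, aeval_X, map_sub, map_mul, pr_lf hp, mul_zero, sub_zero]
  exact DFunLike.congr_fun this G

lemma pderiv_lf (p : Fin 4 → ℝ) (j : Fin 4) : pderiv j (lf p) = C (p j) := by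
  simp [lf, pderiv_X, Pi.single_apply]

lemma grad_inv {p : Fin 4 → ℝ} {G : MvPolynomial (Fin 4) ℝ} (h : sg p G = G) (j : Fin 4) :
    pderiv j G = sg p (pderiv j G) - C (p j / 2) * ∑ i, C (p i) * sg p (pderiv i G) := by
  conv_lhs => rw [← h, sg, pderiv_aeval]
  simp only [map_sub, pderiv_C_mul, pderiv_lf, mul_sub, Finset.sum_sub_distrib]
  congr 1
  · rw [Finset.sum_eq_single j]
    · simp [sg]
    · intro b _ hb
      simp [pderiv_X_of_ne hb]
    · simp
  · rw [Finset.mul_sum]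
    refine Finset.sum_congr rfl fun i _ => ?_
    rw [sg]
    have : (C (p i / 2) * C (p j) : MvPolynomial (Fin 4) ℝ) = C (p j / 2) * C (p i) := by
      rw [← C_mul, ← C_mul]; congr 1; ring
    rw [this]; ring

lemma grad_pr {p : Fin 4 → ℝ} (hp : ∑ j, p j ^ 2 = 4) {G : MvPolynomial (Fin 4) ℝ}
    (h : sg p G = G) : ∑ i, C (p i) * pr p (pderiv i G) = 0 := by
  obtain ⟨j, hj⟩ : ∃ j, p j ≠ 0 := by
    by_contra hc
    push Not at hc
    simp [hc] at hp
  have h1 := congrArg (pr p) (grad_inv h j)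
  simp only [map_sub, map_mul, map_sum, pr_sg hp] at h1
  have h2 : ∀ c : ℝ, pr p (C c) = C c := fun c => by simp [pr, algebraMap_eq]
  simp only [h2] at h1
  have h3 : C (p j / 2) * ∑ i, C (p i) * pr p (pderiv i G) = 0 := by linear_combination h1
  rcases mul_eq_zero.mp h3 with h4 | h4
  · rw [C_eq_zero] at h4
    exact absurd (by linarith) hj
  · exact h4

noncomputable def gmat (k : Fin 4 → MvPolynomial (Fin 4) ℝ) :
    Matrix (Fin 4) (Fin 4) (MvPolynomial (Fin 4) ℝ) := Matrix.of fun j i => pderiv j (k i)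

lemma lf_dvd_det {p : Fin 4 → ℝ} (hp : ∑ j, p j ^ 2 = 4) (k : Fin 4 → MvPolynomial (Fin 4) ℝ)
    (hk : ∀ i, sg p (k i) = k i) : lf p ∣ (gmat k).det := by
  rw [lf_dvd_iff hp]
  rw [AlgHom.map_det]
  rw [← Matrix.exists_vecMul_eq_zero_iff]
  refine ⟨fun i => C (p i), ?_, ?_⟩
  · intro h
    have : ∀ i, p i = 0 := fun i => by simpa using congrFun h i
    simp [this] at hp
  · ext1 i
    have := grad_pr hp (hk i)
    simpa [Matrix.vecMul, dotProduct, gmat] using this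

lemma det_gmat_wh (k : Fin 4 → MvPolynomial (Fin 4) ℝ) (d : Fin 4 → ℕ)
    (hk : ∀ i, (k i).IsHomogeneous (d i)) :
    IsWeightedHomogeneous 1 (gmat k).det (∑ i, (d i - 1)) := by
  rw [← dlt_eq_iff]
  rw [AlgHom.map_det]
  have : (dlt 1).mapMatrix (gmat k) =
      Matrix.of fun j i => Polynomial.X ^ (d i - 1) * (Polynomial.C.mapMatrix (gmat k)) j i := by
    ext1 j i
    have h1 : IsWeightedHomogeneous 1 (pderiv j (k i)) (d i - 1) := (hk i).pderiv
    rw [← dlt_eq_iff] at h1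
    exact h1
  rw [this, Matrix.det_mul_row, Finset.prod_pow_eq_pow_sum, ← RingHom.map_det]

lemma lf_wh (p : Fin 4 → ℝ) : IsWeightedHomogeneous 1 (lf p) 1 := by
  refine IsWeightedHomogeneous.sum _ _ _ fun i _ => ?_
  have := (isWeightedHomogeneous_C (1 : Fin 4 → ℕ) (p i)).mul (isWeightedHomogeneous_X ℝ 1 i)
  simpa using this

lemma prod_lf_dvd {ι : Type*} (s : Finset ι) (P : ι → Fin 4 → ℝ)
    (hP : ∀ a, ∑ j, P a j ^ 2 = 4) (hne : ∀ a b, a ≠ b → pr (P a) (lf (P b)) ≠ 0)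
    (G : MvPolynomial (Fin 4) ℝ) (hG : ∀ a, lf (P a) ∣ G) : ∏ a ∈ s, lf (P a) ∣ G := by
  classical
  induction s using Finset.induction_on with
  | empty => simp
  | insert a s ha ih =>
    obtain ⟨H, rfl⟩ := ih
    rw [Finset.prod_insert ha, mul_comm]
    refine mul_dvd_mul_left _ ?_
    have h1 := hG a
    rw [lf_dvd_iff (hP a)] at h1 ⊢
    rw [map_mul, map_prod] at h1
    rcases mul_eq_zero.mp h1 with h2 | h2
    · obtain ⟨b, hb, h3⟩ := Finset.prod_eq_zero_iff.mp h2
      exact absurd h3 (hne a b (by rintro rfl; exact ha hb))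
    · exact h2

def dg : Fin 4 → ℕ := ![2, 12, 20, 30]

lemma eq_C_of_hom_zero {f : MvPolynomial (Fin 4) ℝ} (h : f.IsHomogeneous 0) : ∃ c, f = C c :=
  ⟨_, (totalDegree_eq_zero_iff_eq_C.mp (by
    by_cases hf : f = 0
    · simp [hf]
    · exact h.totalDegree hf))⟩

lemma sum_dg (d : Fin 4 → ℕ) (hd : d = dg) (i : Fin 4) (n : ℕ) (hn : 0 < n) :
    (∑ j, (Function.update d i n j - 1)) + (d i - 1) = 60 + (n - 1) := by
  subst hd
  fin_cases i <;> simp [Fin.sum_univ_four, dg, Function.update_apply] <;> omega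

section
variable {ι : Type*} [Fintype ι] (P : ι → Fin 4 → ℝ)

lemma det_eq (hcard : Fintype.card ι = 60)
    (hP : ∀ a, ∑ j, P a j ^ 2 = 4) (hne : ∀ a b, a ≠ b → pr (P a) (lf (P b)) ≠ 0)
    (h : Fin 4 → MvPolynomial (Fin 4) ℝ) (hh : ∀ i, (h i).IsHomogeneous (dg i))
    (hinv : ∀ a i, sg (P a) (h i) = h i) (hdet : (gmat h).det ≠ 0) :
    ∃ c : ℝ, c ≠ 0 ∧ (gmat h).det = C c * ∏ a, lf (P a) := by
  obtain ⟨f, hf⟩ := prod_lf_dvd Finset.univ P hP hne _ fun a => lf_dvd_det (hP a) h (hinv a)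
  have h1 := det_gmat_wh h dg hh
  have h2 : IsWeightedHomogeneous 1 (∏ a, lf (P a)) 60 := by
    have := IsWeightedHomogeneous.prod (w := (1 : Fin 4 → ℕ)) Finset.univ (fun a => lf (P a))
      (fun _ => 1) fun a _ => lf_wh (P a)
    simpa [hcard] using this
  rw [hf] at h1 hdet
  have h3 := wh_quot 1 h2 (left_ne_zero_of_mul hdet) h1 (right_ne_zero_of_mul hdet)
  have h4 : f.IsHomogeneous 0 := by
    have := h3.2
    rwa [show ∑ i, (dg i - 1) - 60 = 0 by decide] at this
  obtain ⟨c, rfl⟩ := eq_C_of_hom_zero h4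
  refine ⟨c, ?_, by rw [hf, mul_comm]⟩
  rintro rfl
  simp at hdet

set_option maxHeartbeats 1000000 in
lemma solve_grad (hcard : Fintype.card ι = 60)
    (hP : ∀ a, ∑ j, P a j ^ 2 = 4) (hne : ∀ a b, a ≠ b → pr (P a) (lf (P b)) ≠ 0)
    (h : Fin 4 → MvPolynomial (Fin 4) ℝ) (hh : ∀ i, (h i).IsHomogeneous (dg i))
    (hinv : ∀ a i, sg (P a) (h i) = h i) (hdet : (gmat h).det ≠ 0)
    (n : ℕ) (hn : 0 < n) (f : MvPolynomial (Fin 4) ℝ) (hf : f.IsHomogeneous n)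
    (hfi : ∀ a, sg (P a) f = f) :
    ∃ g : Fin 4 → MvPolynomial (Fin 4) ℝ, (∀ j, ∑ i, pderiv j (h i) * g i = pderiv j f) ∧
      (∀ i, g i = 0 ∨ (dg i ≤ n ∧ (g i).IsHomogeneous (n - dg i))) ∧
      ∀ a i, sg (P a) (g i) = g i := by
  obtain ⟨c, hc, hJ⟩ := det_eq P hcard hP hne h hh hinv hdet
  have hcr : ∀ i, (gmat h).cramer (fun j => pderiv j f) i = (gmat (Function.update h i f)).det := by
    intro i
    rw [Matrix.cramer_apply]
    congr 1
    ext1 j l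
    by_cases hl : l = i
    · subst hl; simp [gmat]
    · simp [gmat, hl]
  have hdv : ∀ i, ∃ g, (gmat h).cramer (fun j => pderiv j f) i = (gmat h).det * g := by
    intro i
    have h1 : ∏ a, lf (P a) ∣ (gmat (Function.update h i f)).det := by
      refine prod_lf_dvd Finset.univ P hP hne _ fun a => lf_dvd_det (hP a) _ fun l => ?_
      by_cases hl : l = i
      · subst hl; simp [hfi]
      · simp [hl, hinv]
    obtain ⟨g, hg⟩ := h1
    refine ⟨C c⁻¹ * g, ?_⟩
    rw [hcr, hg, hJ]
    have : (C c * C c⁻¹ : MvPolynomial (Fin 4) ℝ) = 1 := by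
      rw [← C_mul, mul_inv_cancel₀ hc, C_1]
    linear_combination (-(∏ a, lf (P a)) * g) * this
  choose g hg using hdv
  have hsol : ∀ j, ∑ i, pderiv j (h i) * g i = pderiv j f := by
    intro j
    have h1 := congrFun (Matrix.mulVec_cramer (gmat h) (fun j => pderiv j f)) j
    apply mul_left_cancel₀ hdet
    simp only [Matrix.mulVec, dotProduct, hg, Pi.smul_apply, smul_eq_mul] at h1
    rw [← h1, Finset.mul_sum]
    refine Finset.sum_congr rfl fun i _ => ?_
    simp only [gmat, Matrix.of_apply]
    ring
  refine ⟨g, hsol, ?_, ?_⟩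
  · intro i
    by_cases hgi : g i = 0
    · exact Or.inl hgi
    · right
      have h1 := det_gmat_wh (Function.update h i f) (Function.update dg i n) (by
        intro l
        by_cases hl : l = i
        · subst hl; simpa using hf
        · simpa [hl] using hh l)
      rw [← hcr, hg] at h1
      have h2 := wh_quot 1 (det_gmat_wh h dg hh) hdet h1 hgi
      have h3 := sum_dg dg rfl i n hn
      have h4 : ∑ i, (dg i - 1) = 60 := by decide
      have h5 : 0 < dg i := (show ∀ i, 0 < dg i by decide) i
      rw [h4] at h2
      refine ⟨by omega, ?_⟩
      have h6 := h2.2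
      rwa [show ∑ j, (Function.update dg i n j - 1) - 60 = n - dg i by omega] at h6
  · intro a
    have hsg : ∀ c : ℝ, sg (P a) (C c) = C c := fun c => by simp [sg, algebraMap_eq]
    have hz : (gmat h).mulVec (fun i => sg (P a) (g i) - g i) = 0 := by
      ext1 j
      have e1 := grad_inv (hfi a) j
      simp only [← hsol, map_sum, map_mul] at e1
      have e2 := fun i => grad_inv (hinv a i) j
      simp only [Matrix.mulVec, dotProduct, gmat, Matrix.of_apply, Pi.zero_apply, mul_sub,
        Finset.sum_sub_distrib]
      rw [e1, sub_eq_zero]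
      have e3 : ∀ i, pderiv j (h i) * sg (P a) (g i) =
        sg (P a) (pderiv j (h i)) * sg (P a) (g i) - C (P a j / 2) *
          ∑ l, C (P a l) * (sg (P a) (pderiv l (h i)) * sg (P a) (g i)) := by
        intro i
        conv_lhs => rw [e2 i]
        rw [sub_mul, mul_assoc, Finset.sum_mul]
        simp only [mul_assoc]
      simp only [e3, Finset.sum_sub_distrib, Finset.mul_sum]
      refine congrArg₂ (· - ·) rfl ?_
      exact Finset.sum_comm
    have := Matrix.eq_zero_of_mulVec_eq_zero hdet hz
    intro i
    exact sub_eq_zero.mp (congrFun this i)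

theorem gen (hcard : Fintype.card ι = 60)
    (hP : ∀ a, ∑ j, P a j ^ 2 = 4) (hne : ∀ a b, a ≠ b → pr (P a) (lf (P b)) ≠ 0)
    (h : Fin 4 → MvPolynomial (Fin 4) ℝ) (hh : ∀ i, (h i).IsHomogeneous (dg i))
    (hinv : ∀ a i, sg (P a) (h i) = h i) (hdet : (gmat h).det ≠ 0)
    (k e : Fin 4 → MvPolynomial (Fin 4) ℝ) (he : ∀ i, IsWeightedHomogeneous dg (e i) (dg i))
    (hke : ∀ i, aeval k (e i) = h i) :
    ∀ (n : ℕ) (f : MvPolynomial (Fin 4) ℝ), f.IsHomogeneous n → (∀ a, sg (P a) f = f) →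
      ∃ Q : MvPolynomial (Fin 4) ℝ, IsWeightedHomogeneous dg Q n ∧ aeval k Q = f := by
  intro n
  induction n using Nat.strong_induction_on with
  | _ n ih =>
  intro f hf hfi
  rcases Nat.eq_zero_or_pos n with rfl | hn
  · obtain ⟨c, rfl⟩ := eq_C_of_hom_zero hf
    exact ⟨C c, isWeightedHomogeneous_C _ _, by simp [algebraMap_eq]⟩
  obtain ⟨g, hg1, hg2, hg3⟩ := solve_grad P hcard hP hne h hh hinv hdet n hn f hf hfi
  have hpos : ∀ i, 0 < dg i := by decide
  have hQ : ∀ i, ∃ Q : MvPolynomial (Fin 4) ℝ, IsWeightedHomogeneous dg (e i * Q) n ∧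
      aeval k Q = g i := by
    intro i
    rcases hg2 i with h0 | ⟨h1, h2⟩
    · exact ⟨0, by simpa using isWeightedHomogeneous_zero _ _ _, by simp [h0]⟩
    · obtain ⟨Q, hQ1, hQ2⟩ := ih (n - dg i) (by have := hpos i; omega) (g i) h2 fun a => hg3 a i
      refine ⟨Q, ?_, hQ2⟩
      have := (he i).mul hQ1
      rwa [Nat.add_sub_cancel' h1] at this
  choose Q hQ1 hQ2 using hQ
  refine ⟨C (n : ℝ)⁻¹ * ∑ i, C (dg i : ℝ) * (e i * Q i), ?_, ?_⟩
  · have h1 : IsWeightedHomogeneous dg (∑ i, C (dg i : ℝ) * (e i * Q i)) n := by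
      refine IsWeightedHomogeneous.sum _ _ _ fun i _ => ?_
      simpa using (isWeightedHomogeneous_C dg (dg i : ℝ)).mul (hQ1 i)
    simpa using (isWeightedHomogeneous_C dg ((n : ℝ)⁻¹)).mul h1
  · have e1 := hf.sum_X_mul_pderiv
    have e2 : ∀ i, _ := fun i => (hh i).sum_X_mul_pderiv
    have e3 : ∑ i, C (dg i : ℝ) * (h i * g i) = C (n : ℝ) * f := by
      have : (C (n : ℝ) : MvPolynomial (Fin 4) ℝ) * f = n • f := by
        rw [nsmul_eq_mul, map_natCast]
      rw [this, ← e1]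
      simp only [← hg1, Finset.mul_sum]
      rw [Finset.sum_comm]
      refine Finset.sum_congr rfl fun i _ => ?_
      have := e2 i
      rw [nsmul_eq_mul] at this
      rw [map_natCast, ← mul_assoc, ← this, Finset.sum_mul]
      simp only [mul_assoc]
    rw [map_mul, map_sum]
    simp only [map_mul, hke, hQ2, aeval_C, algebraMap_eq]
    rw [e3, ← mul_assoc, ← C_mul, inv_mul_cancel₀ (by positivity), C_1, one_mul]
end

/-- codes for elements of the ring of golden integers -/
abbrev Gd := ℤ × ℤ
abbrev Vc := Gd × Gd × Gd × Gd

def gz : Gd := (0, 0)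
def go : Gd := (1, 0)
def g2 : Gd := (2, 0)
def gf : Gd := (0, 1)
def gt : Gd := (-1, 1)

def gmul (a b : Gd) : Gd := (a.1 * b.1 + a.2 * b.2, a.1 * b.2 + a.2 * b.1 + a.2 * b.2)

def gdot (a b : Vc) : Gd :=
  gmul a.1 b.1 + gmul a.2.1 b.2.1 + gmul a.2.2.1 b.2.2.1 + gmul a.2.2.2 b.2.2.2

def ghalf (c : Gd) : Gd := (c.1 / 2, c.2 / 2)

def grf (a b : Vc) : Vc :=
  (b.1 - gmul (ghalf (gdot a b)) a.1, b.2.1 - gmul (ghalf (gdot a b)) a.2.1,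
   b.2.2.1 - gmul (ghalf (gdot a b)) a.2.2.1, b.2.2.2 - gmul (ghalf (gdot a b)) a.2.2.2)

/-- the sixty roots up to sign -/
def rts : List Vc := [
   (g2, gz, gz, gz), (gf, go, gt, gz), (gf, go, -gt, gz),
   (gf, -go, gt, gz), (gf, -go, -gt, gz), (gf, gt, gz, go),
   (gf, -gt, gz, go), (gf, gt, gz, -go), (gf, -gt, gz, -go),
   (gf, gz, go, gt), (gf, gz, go, -gt), (gf, gz, -go, gt),
   (gf, gz, -go, -gt), (go, go, go, go), (go, go, go, -go),
   (go, go, -go, go), (go, go, -go, -go), (go, -go, go, go),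
   (go, -go, go, -go), (go, -go, -go, go), (go, -go, -go, -go),
   (go, gf, gz, gt), (go, gf, gz, -gt), (go, -gf, gz, -gt),
   (go, -gf, gz, gt), (go, gt, gf, gz), (go, -gt, gf, gz),
   (go, -gt, -gf, gz), (go, gt, -gf, gz), (go, gz, gt, gf),
   (go, gz, -gt, gf), (go, gz, -gt, -gf), (go, gz, gt, -gf),
   (gt, gf, go, gz), (gt, -gf, -go, gz), (gt, gf, -go, gz),
   (gt, -gf, go, gz), (gt, go, gz, gf), (gt, -go, gz, -gf),
   (gt, -go, gz, gf), (gt, go, gz, -gf), (gt, gz, gf, go),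
   (gt, gz, -gf, -go), (gt, gz, gf, -go), (gt, gz, -gf, go),
   (gz, g2, gz, gz), (gz, gz, g2, gz), (gz, gz, gz, g2),
   (gz, gf, gt, go), (gz, gf, -gt, go), (gz, gf, gt, -go),
   (gz, gf, -gt, -go), (gz, go, gf, gt), (gz, go, gf, -gt),
   (gz, -go, gf, gt), (gz, -go, gf, -gt), (gz, gt, go, gf),
   (gz, -gt, go, gf), (gz, gt, -go, gf), (gz, -gt, -go, gf)]

/-- four generating roots -/
def smps : List Vc := [(gt, gz, gf, go), (go, -gf, gz, gt), (gz, gf, gt, -go), (go, go, go, go)]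

/-- words expressing every root -/
def wds : List (List (Fin 4)) := [
   [3, 0, 1, 2], [2, 3, 0, 1], [2, 1, 0, 3, 0], [1, 2], [1, 2, 0, 3, 2], [3, 1, 0],
   [3, 0, 1], [3, 0, 1, 2, 1], [1, 2, 0, 1], [1, 2, 3, 2], [1, 2, 1], [1, 0, 3, 0],
   [0, 3, 0, 1, 2], [3], [2, 1], [3, 2, 0, 3], [2, 1, 0, 3], [0, 1, 0],
   [0, 3, 1, 2, 1], [2, 3, 2, 1, 0], [0, 1, 2], [3, 0], [3, 2, 1, 0], [3, 1, 2],
   [1], [2, 0, 1, 0], [1, 0, 3, 2], [1, 0, 3], [0, 3, 1, 0], [2, 3],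
   [2, 3, 0], [0, 1, 2, 1], [2, 3, 1, 2], [2, 3, 2], [0, 1], [0, 3, 0],
   [0, 1, 2, 3], [3, 2, 0, 1, 0], [3, 1, 2, 1], [3, 2], [2, 0, 1], [0],
   [0, 1, 2, 3, 2], [0, 3, 2, 1], [2, 0, 3, 0], [3, 0, 1, 0], [2, 0, 3], [3, 2, 1],
   [1, 2, 3], [1, 2, 3, 0], [2], [2, 0, 3, 2], [1, 0], [0, 3, 2],
   [0, 3], [1, 2, 0, 3, 0], [3, 2, 3, 0, 1], [2, 1, 0], [2, 1, 2, 3, 0], [2, 3, 0, 1, 0]]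

def smp (j : Fin 4) : Vc := smps.getD j 0

def wroot : List (Fin 4) → Vc
  | [] => smp 0
  | [j] => smp j
  | j :: i :: l => grf (smp j) (wroot (i :: l))

lemma rts_len : rts.length = 60 := rfl

lemma smp_mem : ∀ j, smp j ∈ rts := by decide +kernel

lemma rts_closed : ∀ j, ∀ b ∈ rts, grf (smp j) b ∈ rts ∨ -grf (smp j) b ∈ rts := by
  decide +kernel

lemma rts_even : ∀ j, ∀ b ∈ rts, 2 * (gdot (smp j) b).1 = 4 * ((gdot (smp j) b).1 / 2) ∧
    2 * (gdot (smp j) b).2 = 4 * ((gdot (smp j) b).2 / 2) := by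
  decide +kernel

lemma rts_norm : ∀ b ∈ rts, gdot b b = (4, 0) := by decide +kernel

lemma rts_pw : rts.Pairwise fun a b => a ≠ b ∧ a ≠ -b := by decide +kernel

lemma rts_words : ∀ a ∈ rts, ∃ w ∈ wds, a = wroot w ∨ a = - wroot w := by
  have h : List.Forall₂ (fun a w => a = wroot w ∨ a = - wroot w) rts wds := by
    decide +kernel
  intro a ha
  obtain ⟨i, hi, rfl⟩ := List.getElem_of_mem ha
  have hl := h.length_eq
  exact ⟨wds[i], List.getElem_mem _, (List.forall₂_iff_get.mp h).2 i hi (hl ▸ hi)⟩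

lemma gr_eq : gr = Real.goldenRatio := rfl

lemma gr_sq : gr ^ 2 = gr + 1 := by rw [gr_eq, Real.goldenRatio_sq]

noncomputable def ev (a : Gd) : ℝ := a.1 + a.2 * gr

lemma ev_add (a b : Gd) : ev (a + b) = ev a + ev b := by simp [ev]; ring
lemma ev_sub (a b : Gd) : ev (a - b) = ev a - ev b := by simp [ev]; ring
lemma ev_neg (a : Gd) : ev (-a) = -ev a := by simp [ev]; ring
lemma ev_mul (a b : Gd) : ev (gmul a b) = ev a * ev b := by
  simp [ev, gmul]
  linear_combination (-(a.2 : ℝ) * b.2) * gr_sq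

lemma ev_inj {a b : Gd} (h : ev a = ev b) : a = b := by
  have hi : Irrational gr := by rw [gr_eq]; exact Real.goldenRatio_irrational
  simp only [ev] at h
  by_cases h2 : a.2 = b.2
  · rw [h2] at h
    have h1 : (a.1 : ℝ) = b.1 := by linarith
    exact Prod.ext (by exact_mod_cast h1) h2
  · exfalso
    apply hi
    refine ⟨((b.1 - a.1 : ℤ) : ℚ) / ((a.2 - b.2 : ℤ) : ℚ), ?_⟩
    have h3 : ((a.2 : ℝ) - b.2) ≠ 0 := sub_ne_zero.mpr (by exact_mod_cast h2)
    push_cast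
    rw [div_eq_iff h3]
    linarith

noncomputable def evv (v : Vc) : Fin 4 → ℝ := ![ev v.1, ev v.2.1, ev v.2.2.1, ev v.2.2.2]

lemma evv_neg (v : Vc) : evv (-v) = -evv v := by
  ext i; fin_cases i <;> simp [evv, ev_neg]

lemma evv_inj {v w : Vc} (h : evv v = evv w) : v = w := by
  have h0 := congrFun h 0
  have h1 := congrFun h 1
  have h2 := congrFun h 2
  have h3 := congrFun h 3
  simp [evv] at h0 h1 h2 h3
  exact Prod.ext (ev_inj h0) (Prod.ext (ev_inj h1) (Prod.ext (ev_inj h2) (ev_inj h3)))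

lemma ev_gdot (v w : Vc) : ev (gdot v w) = ∑ i, evv v i * evv w i := by
  simp [gdot, ev_add, ev_mul, evv, Fin.sum_univ_four]

noncomputable def rfv (p q : Fin 4 → ℝ) : Fin 4 → ℝ := fun i => q i - (∑ j, p j * q j) / 2 * p i

lemma rfv_neg (p q : Fin 4 → ℝ) : rfv p (-q) = -rfv p q := by
  ext i; simp [rfv]; ring

lemma lf_neg (p : Fin 4 → ℝ) : lf (-p) = -lf p := by
  simp [lf]

lemma sg_neg (p : Fin 4 → ℝ) : sg (-p) = sg p := by
  refine MvPolynomial.algHom_ext fun i => ?_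
  simp only [sg, aeval_X, lf_neg, Pi.neg_apply, neg_div, C_neg]
  ring

lemma lf_subst (p q : Fin 4 → ℝ) (r : ℝ) :
    aeval (fun i => X i - C (p i / r) * lf p) (lf q) =
      lf (fun i => q i - (∑ j, p j * q j) / r * p i) := by
  simp only [lf, map_sum, map_mul, aeval_X, aeval_C, algebraMap_eq, C_sub, sub_mul,
    Finset.sum_sub_distrib, mul_sub]
  congr 1
  rw [Finset.sum_div]
  simp only [map_sum, Finset.sum_mul, Finset.mul_sum]
  rw [Finset.sum_comm]
  refine Finset.sum_congr rfl fun i _ => Finset.sum_congr rfl fun j _ => ?_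
  simp only [← mul_assoc, ← C_mul]
  congr 2
  ring

lemma sg_lf (p q : Fin 4 → ℝ) : sg p (lf q) = lf (rfv p q) := lf_subst p q 2

lemma X_eq_lf (i : Fin 4) : (X i : MvPolynomial (Fin 4) ℝ) = lf (Pi.single i 1) := by
  simp [lf, Pi.single_apply]

lemma rfv_conj {p : Fin 4 → ℝ} (hp : ∑ j, p j ^ 2 = 4) (q v : Fin 4 → ℝ) :
    rfv (rfv p q) v = rfv p (rfv q (rfv p v)) := by
  ext i
  simp only [rfv, Fin.sum_univ_four] at hp ⊢
  obtain ⟨a, ha⟩ : ∃ a, a = p 0 * q 0 + p 1 * q 1 + p 2 * q 2 + p 3 * q 3 := ⟨_, rfl⟩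
  obtain ⟨b, hb⟩ : ∃ b, b = p 0 * v 0 + p 1 * v 1 + p 2 * v 2 + p 3 * v 3 := ⟨_, rfl⟩
  obtain ⟨c, hc⟩ : ∃ c, c = q 0 * v 0 + q 1 * v 1 + q 2 * v 2 + q 3 * v 3 := ⟨_, rfl⟩
  obtain ⟨e, he⟩ : ∃ e, e = q 0 * (v 0 - b / 2 * p 0) + q 1 * (v 1 - b / 2 * p 1) +
    q 2 * (v 2 - b / 2 * p 2) + q 3 * (v 3 - b / 2 * p 3) := ⟨_, rfl⟩
  have he' : e = c - a * b / 2 := by rw [he, hc, ha]; ring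
  rw [← ha, ← hb, ← he]
  have h1 : (q 0 - a / 2 * p 0) * v 0 + (q 1 - a / 2 * p 1) * v 1 + (q 2 - a / 2 * p 2) * v 2 +
    (q 3 - a / 2 * p 3) * v 3 = c - a * b / 2 := by rw [hc, hb]; ring
  have h2 : p 0 * (v 0 - b / 2 * p 0 - e / 2 * q 0) + p 1 * (v 1 - b / 2 * p 1 - e / 2 * q 1) +
     p 2 * (v 2 - b / 2 * p 2 - e / 2 * q 2) + p 3 * (v 3 - b / 2 * p 3 - e / 2 * q 3) =
     b - b / 2 * 4 - e / 2 * a := by rw [ha, ← hp]; linear_combination -hb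
  rw [h1, h2, he']
  ring

lemma sg_conj {p : Fin 4 → ℝ} (hp : ∑ j, p j ^ 2 = 4) (q : Fin 4 → ℝ)
    {f : MvPolynomial (Fin 4) ℝ} (h1 : sg p f = f) (h2 : sg q f = f) : sg (rfv p q) f = f := by
  have h3 : sg (rfv p q) = (sg p).comp ((sg q).comp (sg p)) := by
    refine MvPolynomial.algHom_ext fun i => ?_
    simp only [AlgHom.comp_apply, X_eq_lf, sg_lf, rfv_conj hp]
  rw [h3, AlgHom.comp_apply, AlgHom.comp_apply, h1, h2, h1]

lemma evv_norm {a : Vc} (ha : a ∈ rts) : ∑ j, evv a j ^ 2 = 4 := by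
  have := ev_gdot a a
  rw [rts_norm a ha] at this
  simp only [sq, ← this]
  simp [ev]

lemma evv_grf_of {a b : Vc} (h : 2 * (gdot a b).1 = 4 * ((gdot a b).1 / 2) ∧
    2 * (gdot a b).2 = 4 * ((gdot a b).2 / 2)) : evv (grf a b) = rfv (evv a) (evv b) := by
  have h1 : ev (ghalf (gdot a b)) = (∑ j, evv a j * evv b j) / 2 := by
    rw [← ev_gdot]
    obtain ⟨h1, h2⟩ := h
    have h1' : (2 : ℝ) * (gdot a b).1 = 4 * ((gdot a b).1 / 2 : ℤ) := by exact_mod_cast h1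
    have h2' : (2 : ℝ) * (gdot a b).2 = 4 * ((gdot a b).2 / 2 : ℤ) := by exact_mod_cast h2
    simp only [ev, ghalf]
    linear_combination (-1 / 4 : ℝ) * h1' - (gr / 4) * h2'
  ext i
  simp only [rfv, ← h1]
  fin_cases i <;> simp [evv, grf, ev_sub, ev_mul]

lemma evv_grf (j : Fin 4) {b : Vc} (hb : b ∈ rts) :
    evv (grf (smp j) b) = rfv (evv (smp j)) (evv b) := evv_grf_of (rts_even j b hb)

/-- the root system -/
def PhiR : Set (Fin 4 → ℝ) := {v | ∃ a ∈ rts, v = evv a ∨ v = -evv a}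

lemma PhiR_neg {v : Fin 4 → ℝ} (hv : v ∈ PhiR) : -v ∈ PhiR := by
  obtain ⟨a, ha, rfl | rfl⟩ := hv
  · exact ⟨a, ha, Or.inr rfl⟩
  · exact ⟨a, ha, Or.inl (neg_neg _)⟩

lemma PhiR_rfv (j : Fin 4) {v : Fin 4 → ℝ} (hv : v ∈ PhiR) : rfv (evv (smp j)) v ∈ PhiR := by
  have key : ∀ a ∈ rts, rfv (evv (smp j)) (evv a) ∈ PhiR := by
    intro a ha
    rw [← evv_grf j ha]
    rcases rts_closed j a ha with h | h
    · exact ⟨_, h, Or.inl rfl⟩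
    · exact ⟨_, h, Or.inr (by rw [evv_neg, neg_neg])⟩
  obtain ⟨a, ha, rfl | rfl⟩ := hv
  · exact key a ha
  · rw [rfv_neg]; exact PhiR_neg (key a ha)

lemma gdot_neg (a b : Vc) : gdot a (-b) = - gdot a b := by
  ext <;> simp [gdot, gmul] <;> ring

lemma rts_even' (j : Fin 4) (b : Vc) (hb : b ∈ rts ∨ -b ∈ rts) :
    evv (grf (smp j) b) = rfv (evv (smp j)) (evv b) := by
  rcases hb with hb | hb
  · exact evv_grf j hb
  · apply evv_grf_of
    have := rts_even j _ hb
    rw [gdot_neg] at this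
    simp only [Prod.fst_neg, Prod.snd_neg] at this
    omega

lemma grf_neg (j : Fin 4) (b : Vc) (hb : -b ∈ rts) : grf (smp j) b = - grf (smp j) (-b) := by
  apply evv_inj
  rw [evv_neg, rts_even' j b (Or.inr hb), evv_grf j hb, evv_neg, rfv_neg, neg_neg]

lemma wroot_mem (w : List (Fin 4)) : wroot w ∈ rts ∨ -wroot w ∈ rts := by
  match w with
  | [] => exact Or.inl (smp_mem 0)
  | [j] => exact Or.inl (smp_mem j)
  | j :: i :: l =>
    rw [wroot]
    rcases wroot_mem (i :: l) with h | h
    · exact rts_closed j _ h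
    · rw [grf_neg j _ h, neg_neg]; exact (rts_closed j _ h).symm

lemma sg_wroot {f : MvPolynomial (Fin 4) ℝ} (h : ∀ j, sg (evv (smp j)) f = f)
    (w : List (Fin 4)) : sg (evv (wroot w)) f = f := by
  match w with
  | [] => exact h 0
  | [j] => exact h j
  | j :: i :: l =>
    rw [wroot, rts_even' j _ (wroot_mem _)]
    exact sg_conj (evv_norm (smp_mem j)) _ (h j) (sg_wroot h (i :: l))

lemma sg_all {f : MvPolynomial (Fin 4) ℝ} (h : ∀ j, sg (evv (smp j)) f = f) :
    ∀ a ∈ rts, sg (evv a) f = f := by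
  have key := sg_wroot h
  intro a ha
  obtain ⟨w, -, hw | hw⟩ := rts_words a ha
  · rw [hw]; exact key w
  · rw [hw, evv_neg, sg_neg]; exact key w

noncomputable def Pt (a : Fin 60) : Fin 4 → ℝ := evv (rts.get a)

lemma Pt_norm (a : Fin 60) : ∑ j, Pt a j ^ 2 = 4 := evv_norm (List.get_mem _ _)

lemma Pt_ne {a b : Fin 60} (h : a ≠ b) : Pt a ≠ Pt b ∧ Pt a ≠ -Pt b := by
  have key : ∀ a b : Fin 60, a < b → Pt a ≠ Pt b ∧ Pt a ≠ -Pt b := by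
    intro a b hab
    have := List.pairwise_iff_get.mp rts_pw a b hab
    refine ⟨fun h => this.1 (evv_inj h), fun h => this.2 (evv_inj ?_)⟩
    rw [evv_neg]; exact h
  rcases lt_or_gt_of_ne h with h | h
  · exact key a b h
  · refine ⟨(key b a h).1.symm, fun h2 => (key b a h).2 ?_⟩
    rw [h2, neg_neg]

lemma lf_inj {p q : Fin 4 → ℝ} (h : lf p = lf q) : p = q := by
  ext j
  have := congrArg (pderiv j) h
  rw [pderiv_lf, pderiv_lf] at this
  exact C_injective _ _ this

lemma Pt_pr (a b : Fin 60) (h : a ≠ b) : pr (Pt a) (lf (Pt b)) ≠ 0 := by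
  intro h0
  have h1 : pr (Pt a) (lf (Pt b)) = lf (fun j => Pt b j - (∑ j, Pt a j * Pt b j) / 4 * Pt a j) :=
    lf_subst _ _ 4
  rw [h1, show (0 : MvPolynomial (Fin 4) ℝ) = lf 0 by simp [lf]] at h0
  have h2 := fun j => congrFun (lf_inj h0) j
  set c := ∑ j, Pt a j * Pt b j with hc
  simp only [Pi.zero_apply] at h2
  have h3 : ∀ j, Pt b j = c / 4 * Pt a j := fun j => by linarith [h2 j]
  have h4 : (4 : ℝ) = (c / 4) ^ 2 * 4 := by
    conv_lhs => rw [← Pt_norm b]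
    rw [show (c / 4) ^ 2 * 4 = (c / 4) ^ 2 * ∑ j, Pt a j ^ 2 by rw [Pt_norm], Finset.mul_sum]
    exact Finset.sum_congr rfl fun j _ => by rw [h3 j]; ring
  have h5 : (c / 4 - 1) * (c / 4 + 1) = 0 := by linarith
  rcases mul_eq_zero.mp h5 with h6 | h6
  · exact (Pt_ne h).1 (funext fun j => by rw [h3 j]; rw [sub_eq_zero.mp h6, one_mul])
  · refine (Pt_ne h).2 (funext fun j => ?_)
    rw [Pi.neg_apply, h3 j, show c / 4 = -1 by linarith]; ring

def gpow (a : Gd) : ℕ → Gd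
  | 0 => go
  | n + 1 => gmul a (gpow a n)

def gc (p : Vc) : Fin 4 → Gd := ![p.1, p.2.1, p.2.2.1, p.2.2.2]

def gent (l : List Vc) (pt : Vc) (k : ℕ) (j : Fin 4) : Gd :=
  l.foldr (fun p s => gmul (gc p j) (gpow (gdot p pt) k) + s) gz

def gdet3 (a b c : Fin 4 → Gd) (i j k : Fin 4) : Gd :=
  gmul (a i) (gmul (b j) (c k) - gmul (b k) (c j)) - gmul (a j) (gmul (b i) (c k) - gmul (b k) (c i))
    + gmul (a k) (gmul (b i) (c j) - gmul (b j) (c i))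

def gdet4 (a b c d : Fin 4 → Gd) : Gd :=
  gmul (a 0) (gdet3 b c d 1 2 3) - gmul (a 1) (gdet3 b c d 0 2 3) + gmul (a 2) (gdet3 b c d 0 1 3)
    - gmul (a 3) (gdet3 b c d 0 1 2)

def pt0 : Vc := ((3, 0), (2, 0), (1, 0), (1, 0))

lemma gdet_ne : gdet4 (gc pt0) (gent rts pt0 11) (gent rts pt0 19) (gent rts pt0 29) ≠ (0, 0) := by
  decide +kernel

lemma ev_pow (a : Gd) (n : ℕ) : ev (gpow a n) = ev a ^ n := by
  induction n with
  | zero => simp [gpow, go, ev]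
  | succ n ih => rw [gpow, ev_mul, ih, pow_succ']

lemma ev_zero : ev gz = 0 := by simp [ev, gz]

lemma ev_gc (p : Vc) (j : Fin 4) : ev (gc p j) = evv p j := by
  fin_cases j <;> simp [gc, evv]

lemma ev_gent (l : List Vc) (pt : Vc) (k : ℕ) (j : Fin 4) : ev (gent l pt k j) =
    (l.map fun p => evv p j * (∑ i, evv p i * evv pt i) ^ k).sum := by
  induction l with
  | nil => simp [gent, ev_zero]
  | cons a l ih =>
    rw [List.map_cons, List.sum_cons, ← ih]
    simp only [gent, List.foldr_cons, ev_add, ev_mul, ev_pow, ev_gdot, ev_gc]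

noncomputable def EE (k : ℕ) : MvPolynomial (Fin 4) ℝ := ∑ a, lf (Pt a) ^ k

noncomputable def xq : MvPolynomial (Fin 4) ℝ := ∑ i, X i ^ 2

lemma EE_hom (k : ℕ) : (EE k).IsHomogeneous k := by
  refine IsHomogeneous.sum _ _ _ fun a _ => ?_
  have : (lf (Pt a)).IsHomogeneous 1 := lf_wh (Pt a)
  simpa using this.pow k

lemma xq_hom : xq.IsHomogeneous 2 := by
  refine IsHomogeneous.sum _ _ _ fun i _ => ?_
  simpa using (isHomogeneous_X ℝ i).pow 2

lemma rfv_invol {p : Fin 4 → ℝ} (hp : ∑ j, p j ^ 2 = 4) (v : Fin 4 → ℝ) :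
    rfv p (rfv p v) = v := by
  ext i
  have h1 : ∑ j, p j * rfv p v j = - ∑ j, p j * v j := by
    have : ∀ j, p j * rfv p v j = p j * v j - (∑ j, p j * v j) / 2 * p j ^ 2 := fun j => by
      simp only [rfv]; ring
    simp only [this, Finset.sum_sub_distrib, ← Finset.mul_sum, hp]
    ring
  rw [rfv, h1, rfv]
  ring

lemma EE_sg (j : Fin 4) (k : ℕ) (hk : Even k) : sg (evv (smp j)) (EE k) = EE k := by
  have h1 : ∀ b, ∃ c, rfv (evv (smp j)) (Pt b) = Pt c ∨ rfv (evv (smp j)) (Pt b) = -Pt c := by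
    intro b
    obtain ⟨a, ha, h⟩ := PhiR_rfv j (v := Pt b) ⟨_, List.get_mem _ _, Or.inl rfl⟩
    obtain ⟨c, hc⟩ := List.get_of_mem ha
    have hc' : Pt c = evv a := congrArg evv hc
    exact ⟨c, by rw [hc']; exact h⟩
  choose π hπ using h1
  have hnorm := evv_norm (smp_mem j)
  have hinj : Function.Injective π := by
    intro b b' hb
    by_contra hne
    have h2 := hπ b
    have h3 := hπ b'
    rw [← hb] at h3
    have key : rfv (evv (smp j)) (Pt b) = rfv (evv (smp j)) (Pt b') ∨
        rfv (evv (smp j)) (Pt b) = rfv (evv (smp j)) (-Pt b') := by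
      rw [rfv_neg]
      rcases h2 with h2 | h2 <;> rcases h3 with h3 | h3 <;> rw [h2, h3] <;> simp
    rcases key with h4 | h4
    · have := congrArg (rfv (evv (smp j))) h4
      rw [rfv_invol hnorm, rfv_invol hnorm] at this
      exact (Pt_ne hne).1 this
    · have := congrArg (rfv (evv (smp j))) h4
      rw [rfv_invol hnorm, rfv_invol hnorm] at this
      exact (Pt_ne hne).2 this
  have hbij := Finite.injective_iff_bijective.mp hinj
  simp only [EE, map_sum, map_pow, sg_lf]
  rw [← hbij.sum_comp (fun a => lf (Pt a) ^ k)]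
  refine Finset.sum_congr rfl fun b _ => ?_
  rcases hπ b with h | h
  · rw [h]
  · rw [h, lf_neg, hk.neg_pow]

lemma xq_sg {p : Fin 4 → ℝ} (hp : ∑ j, p j ^ 2 = 4) : sg p xq = xq := by
  have h1 : sg p xq = ∑ i, (X i ^ 2 - lf p * (C (p i) * X i) + C (p i ^ 2) * C (1 / 4) * lf p ^ 2) := by
    simp only [xq, sg, map_sum, map_pow, aeval_X]
    refine Finset.sum_congr rfl fun i _ => ?_
    have : (C (p i / 2) : MvPolynomial (Fin 4) ℝ) = C (p i) * C (1 / 2) := by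
      rw [← C_mul]; congr 1; ring
    have h2 : (C (1 / 4) : MvPolynomial (Fin 4) ℝ) = C (1 / 2) * C (1 / 2) := by
      rw [← C_mul]; norm_num
    have h3 : (2 : MvPolynomial (Fin 4) ℝ) * C (1 / 2) = 1 := by
      rw [show (2 : MvPolynomial (Fin 4) ℝ) = C 2 from (map_ofNat C 2).symm, ← C_mul]; norm_num
    rw [this, h2]
    linear_combination (- X i * C (p i) * lf p) * h3
  rw [h1, Finset.sum_add_distrib, Finset.sum_sub_distrib, ← Finset.mul_sum, ← lf, ← Finset.sum_mul,
    ← Finset.sum_mul, ← map_sum, hp, ← C_mul]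
  norm_num
  rw [xq]
  ring

noncomputable def hgen : Fin 4 → MvPolynomial (Fin 4) ℝ := ![xq, EE 12, EE 20, EE 30]

lemma hgen_hom (i : Fin 4) : (hgen i).IsHomogeneous (dg i) := by
  fin_cases i
  · exact xq_hom
  · exact EE_hom 12
  · exact EE_hom 20
  · exact EE_hom 30

lemma hgen_sg (a : Fin 60) (i : Fin 4) : sg (Pt a) (hgen i) = hgen i := by
  refine sg_all (fun j => ?_) _ (List.get_mem _ _)
  fin_cases i
  · exact xq_sg (evv_norm (smp_mem j))
  · exact EE_sg j 12 (by decide)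
  · exact EE_sg j 20 (by decide)
  · exact EE_sg j 30 (by decide)

lemma eval_pderiv_EE (v : Vc) (k : ℕ) (j : Fin 4) :
    eval (evv v) (pderiv j (EE (k + 1))) = (k + 1) * ev (gent rts v k j) := by
  have h1 : (rts.map fun p => evv p j * (∑ i, evv p i * evv v i) ^ k).sum =
      ∑ a : Fin 60, Pt a j * (∑ i, Pt a i * evv v i) ^ k := by
    rw [← List.sum_ofFn]
    congr 1
  rw [ev_gent, h1, EE, map_sum, map_sum, Finset.mul_sum]
  refine Finset.sum_congr rfl fun a _ => ?_
  rw [pderiv_pow, pderiv_lf]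
  simp [lf]
  ring

lemma hgen_det : (gmat hgen).det ≠ 0 := by
  intro h0
  have h1 := congrArg (eval (evv pt0)) h0
  rw [RingHom.map_det, map_zero] at h1
  have h2 : (eval (evv pt0)).mapMatrix (gmat hgen) = Matrix.of fun j i =>
      ![2, 12, 20, 30] i * ![ev (gc pt0 j), ev (gent rts pt0 11 j), ev (gent rts pt0 19 j),
        ev (gent rts pt0 29 j)] i := by
    ext1 j i
    fin_cases i
    · simp [gmat, hgen, xq, ev_gc, pderiv_X, Pi.single_apply]
    · simpa [gmat, hgen] using (eval_pderiv_EE pt0 11 j).trans (by norm_num)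
    · simpa [gmat, hgen] using (eval_pderiv_EE pt0 19 j).trans (by norm_num)
    · simpa [gmat, hgen] using (eval_pderiv_EE pt0 29 j).trans (by norm_num)
  rw [h2] at h1
  have h1 := (Matrix.det_mul_row ![2, 12, 20, 30] (Matrix.of fun j i => ![ev (gc pt0 j),
    ev (gent rts pt0 11 j), ev (gent rts pt0 19 j), ev (gent rts pt0 29 j)] i)).symm.trans h1
  have h3 := (mul_eq_zero.mp h1).resolve_left (by simp [Fin.prod_univ_four])
  apply gdet_ne
  apply ev_inj
  rw [show ev (0, 0) = 0 from ev_zero, ← h3]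
  rw [← Matrix.det_transpose]
  simp only [Matrix.det_succ_row_zero, Matrix.det_fin_zero]
  simp [gdet4, gdet3, ev_add, ev_sub, ev_mul, Fin.sum_univ_succ, Fin.succAbove]
  ring

lemma gr_pow_fib (n : ℕ) : gr ^ (n + 1) = (Nat.fib n : ℝ) + Nat.fib (n + 1) * gr := by
  induction n with
  | zero => simp
  | succ n ih =>
    rw [pow_succ, ih, Nat.fib_add_two]
    push_cast
    linear_combination (Nat.fib (n + 1) : ℝ) * gr_sq

lemma gm_pow_fib (n : ℕ) : (gr - 1) ^ (n + 1) =
    (-1) ^ (n + 1) * ((Nat.fib (n + 2) : ℝ) - Nat.fib (n + 1) * gr) := by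
  induction n with
  | zero => norm_num [Nat.fib_add_two]
  | succ n ih =>
    rw [pow_succ, ih, Nat.fib_add_two (n := n + 1), Nat.fib_add_two (n := n)]
    push_cast
    linear_combination ((-1 : ℝ) ^ n * (Nat.fib (n + 1) : ℝ)) * gr_sq

lemma gp2 : gr ^ 2 = 1 + gr := by rw [gr_pow_fib]; norm_num [Nat.fib_add_two]
lemma gp3 : gr ^ 3 = 1 + 2 * gr := by rw [gr_pow_fib]; norm_num [Nat.fib_add_two]
lemma gp4 : gr ^ 4 = 2 + 3 * gr := by rw [gr_pow_fib]; norm_num [Nat.fib_add_two]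
lemma gp5 : gr ^ 5 = 3 + 5 * gr := by rw [gr_pow_fib]; norm_num [Nat.fib_add_two]
lemma gp6 : gr ^ 6 = 5 + 8 * gr := by rw [gr_pow_fib]; norm_num [Nat.fib_add_two]
lemma gp7 : gr ^ 7 = 8 + 13 * gr := by rw [gr_pow_fib]; norm_num [Nat.fib_add_two]
lemma gp8 : gr ^ 8 = 13 + 21 * gr := by rw [gr_pow_fib]; norm_num [Nat.fib_add_two]
lemma gp9 : gr ^ 9 = 21 + 34 * gr := by rw [gr_pow_fib]; norm_num [Nat.fib_add_two]
lemma gp10 : gr ^ 10 = 34 + 55 * gr := by rw [gr_pow_fib]; norm_num [Nat.fib_add_two]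
lemma gp11 : gr ^ 11 = 55 + 89 * gr := by rw [gr_pow_fib]; norm_num [Nat.fib_add_two]

def bV : List Vc := (rts.drop 1).take 12
def bD : List Vc := (rts.drop 13).take 20
def bU : List Vc := (rts.drop 33).take 12
def bN : List Vc := rts.drop 45

lemma rts_eq : rts = (g2, gz, gz, gz) :: (bV ++ (bD ++ (bU ++ bN))) := by decide +kernel
lemma bV_fst : ∀ p ∈ bV, p.1 = gf := by decide +kernel
lemma bD_fst : ∀ p ∈ bD, p.1 = go := by decide +kernel
lemma bU_fst : ∀ p ∈ bU, p.1 = gt := by decide +kernel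
lemma bN_fst : ∀ p ∈ bN, p.1 = gz := by decide +kernel

noncomputable def mom (b : List Vc) (j : ℕ) (x y z : ℝ) : ℝ :=
  (b.map fun p => (ev p.2.1 * x + ev p.2.2.1 * y + ev p.2.2.2 * z) ^ j).sum

lemma sum_blk (b : List Vc) (c : Gd) (hb : ∀ p ∈ b, p.1 = c) (w : Gd → ℝ) (j : ℕ) (x y z : ℝ) :
    (b.map fun p => w p.1 * (ev p.2.1 * x + ev p.2.2.1 * y + ev p.2.2.2 * z) ^ j).sum =
      w c * mom b j x y z := by
  rw [mom, ← List.sum_map_mul_left]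
  congr 1
  exact List.map_congr_left fun p hp => by rw [hb p hp]

lemma sum_rts (w : Gd → ℝ) (j : ℕ) (x y z : ℝ) :
    (rts.map fun p => w p.1 * (ev p.2.1 * x + ev p.2.2.1 * y + ev p.2.2.2 * z) ^ j).sum =
      w g2 * 0 ^ j + w gf * mom bV j x y z + w go * mom bD j x y z + w gt * mom bU j x y z +
        w gz * mom bN j x y z := by
  rw [rts_eq, List.map_cons, List.sum_cons]
  simp only [List.map_append, List.sum_append]
  rw [sum_blk bV gf bV_fst, sum_blk bD go bD_fst, sum_blk bU gt bU_fst, sum_blk bN gz bN_fst]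
  simp only [ev_zero, zero_mul, add_zero]
  ring

noncomputable def tm (x y z : ℝ) (t : Gd × Gd × Gd) : ℝ := ev t.1 * x + ev t.2.1 * y + ev t.2.2 * z

def tsc (c : Gd) (t : Gd × Gd × Gd) : Gd × Gd × Gd := (gmul c t.1, gmul c t.2.1, gmul c t.2.2)

lemma mom_eq (b : List Vc) (j : ℕ) (x y z : ℝ) :
    mom b j x y z = ((b.map Prod.snd).map fun t => tm x y z t ^ j).sum := by
  rw [List.map_map]; rfl

lemma mom_sc (b b' : List Vc) (c : Gd) (h : (b'.map Prod.snd).Perm ((b.map Prod.snd).map (tsc c)))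
    (j : ℕ) (x y z : ℝ) : mom b' j x y z = ev c ^ j * mom b j x y z := by
  rw [mom_eq, mom_eq, (h.map _).sum_eq, List.map_map, ← List.sum_map_mul_left]
  congr 1
  refine List.map_congr_left fun t _ => ?_
  simp only [Function.comp, tm, tsc, ev_mul]
  rw [← mul_pow]
  congr 1
  ring

lemma mom_odd (b : List Vc) (h : (b.map Prod.snd).Perm ((b.map Prod.snd).map (tsc (-go))))
    (j : ℕ) (hj : Odd j) (x y z : ℝ) : mom b j x y z = 0 := by
  have := mom_sc b b (-go) h j x y z
  rw [ev_neg, hj.neg_pow, show ev go = 1 by simp [ev, go], one_pow] at this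
  linarith

lemma U_eq (j : ℕ) (x y z : ℝ) : mom bU j x y z = gr ^ j * mom bV j x y z := by
  have := mom_sc bV bU gf (by decide +kernel) j x y z
  rwa [show ev gf = gr by simp [ev, gf]] at this

lemma V_odd (j : ℕ) (hj : Odd j) (x y z : ℝ) : mom bV j x y z = 0 :=
  mom_odd bV (by decide +kernel) j hj x y z

lemma D_odd (j : ℕ) (hj : Odd j) (x y z : ℝ) : mom bD j x y z = 0 :=
  mom_odd bD (by decide +kernel) j hj x y z

section
variable (x y z : ℝ)

lemma V_zero : mom bV 0 x y z = 12 := by simp [mom, bV, rts]; norm_num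
lemma D_zero : mom bD 0 x y z = 20 := by simp [mom, bD, rts]; norm_num

lemma V_two : mom bV 2 x y z = (12 - 4 * gr) * (x ^ 2 + y ^ 2 + z ^ 2) := by
  simp [mom, bV, rts, ev, gz, go, gf, gt]
  ring_nf
  simp only [gp2]
  ring

lemma V_four : mom bV 4 x y z = (24 - 12 * gr) * (x ^ 2 + y ^ 2 + z ^ 2) ^ 2 := by
  simp [mom, bV, rts, ev, gz, go, gf, gt]
  ring_nf
  simp only [gp2, gp3, gp4]
  ring

lemma V_eight : mom bV 8 x y z = (-700 / 3 + 140 * gr) * (x ^ 2 + y ^ 2 + z ^ 2) ^ 4 +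
    (28 / 5 - 28 / 15 * gr) * (x ^ 2 + y ^ 2 + z ^ 2) * mom bV 6 x y z := by
  simp [mom, bV, rts, ev, gz, go, gf, gt]
  ring_nf
  simp only [gp2, gp3, gp4, gp5, gp6, gp7, gp8]
  ring

lemma D_two : mom bD 2 x y z = 20 * (x ^ 2 + y ^ 2 + z ^ 2) := by
  simp [mom, bD, rts, ev, gz, go, gf, gt]
  ring_nf
  simp only [gp2]
  ring

lemma D_four : mom bD 4 x y z = 36 * (x ^ 2 + y ^ 2 + z ^ 2) ^ 2 := by
  simp [mom, bD, rts, ev, gz, go, gf, gt]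
  ring_nf
  simp only [gp2, gp3, gp4]
  ring

lemma D_six : mom bD 6 x y z = 120 * (x ^ 2 + y ^ 2 + z ^ 2) ^ 3 -
    (3 + 4 * gr) * mom bV 6 x y z := by
  simp [mom, bD, bV, rts, ev, gz, go, gf, gt]
  ring_nf
  simp only [gp2, gp3, gp4, gp5, gp6, gp7]
  ring

lemma D_eight : mom bD 8 x y z = 420 * (x ^ 2 + y ^ 2 + z ^ 2) ^ 4 -
    (28 / 5) * (x ^ 2 + y ^ 2 + z ^ 2) * ((3 + 4 * gr) * mom bV 6 x y z) := by
  simp [mom, bD, bV, rts, ev, gz, go, gf, gt]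
  ring_nf
  simp only [gp2, gp3, gp4, gp5, gp6, gp7, gp8]
  ring

set_option maxRecDepth 10000 in
lemma D_ten : mom bD 10 x y z = 3360 * (x ^ 2 + y ^ 2 + z ^ 2) ^ 5 -
    84 * (x ^ 2 + y ^ 2 + z ^ 2) ^ 2 * ((3 + 4 * gr) * mom bV 6 x y z) +
    5 * ((7 + 11 * gr) * mom bV 10 x y z) := by
  simp [mom, bD, bV, rts, ev, gz, go, gf, gt]
  ring_nf
  simp only [gp2, gp3, gp4, gp5, gp6, gp7, gp8, gp9, gp10, gp11]
  ring
end

set_option linter.unusedSimpArgs false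
set_option linter.flexible false

noncomputable def qq (x y z : ℝ) : ℝ := x ^ 2 + y ^ 2 + z ^ 2
noncomputable def G6 (x y z : ℝ) : ℝ := (3 + 4 * gr) * mom bV 6 x y z
noncomputable def G10 (x y z : ℝ) : ℝ := (7 + 11 * gr) * mom bV 10 x y z

/-- coefficients of the expansion of the invariants at the first coordinate point -/
noncomputable def cE (k j : ℕ) (x y z : ℝ) : ℝ :=
  k.choose j * (2 ^ (k - j) * 0 ^ j + gr ^ (k - j) * mom bV j x y z + mom bD j x y z +
    (gr - 1) ^ (k - j) * mom bU j x y z)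

section
variable (x y z : ℝ)

lemma cE_odd (k j : ℕ) (hj : Odd j) : cE k j x y z = 0 := by
  have h0 : j ≠ 0 := by rintro rfl; simp at hj
  simp [cE, U_eq, V_odd j hj, D_odd j hj, h0]

lemma c12_0 : cE 12 0 x y z = (7980) * (1) := by
  have h1 := gr_pow_fib 11
  have h2 := gm_pow_fib 11
  norm_num at h1 h2
  have h3 : Nat.choose 12 0 = 1 := by 
      rw [Nat.choose_eq_descFactorial_div_factorial]; decide +kernel
  simp only [cE, U_eq, V_zero, D_zero, G6, G10, qq, h3]
  norm_num [h1, h2]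
  ring

lemma c12_2 : cE 12 2 x y z = (46200) * (qq x y z) := by
  have h1 := gr_pow_fib 9
  have h2 := gm_pow_fib 9
  norm_num at h1 h2
  have h3 : Nat.choose 12 2 = 66 := by 
      rw [Nat.choose_eq_descFactorial_div_factorial]; decide +kernel
  simp only [cE, U_eq, V_two, D_two, G6, G10, qq, h3]
  norm_num [h1, h2]
  ring_nf
  simp only [gp2, gp3, gp4, gp5, gp6, gp7, gp8, gp9, gp10, gp11]
  ring

lemma c12_4 : cE 12 4 x y z = (124740) * (qq x y z ^ 2) := by
  have h1 := gr_pow_fib 7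
  have h2 := gm_pow_fib 7
  norm_num at h1 h2
  have h3 : Nat.choose 12 4 = 495 := by 
      rw [Nat.choose_eq_descFactorial_div_factorial]; decide +kernel
  simp only [cE, U_eq, V_four, D_four, G6, G10, qq, h3]
  norm_num [h1, h2]
  ring_nf
  simp only [gp2, gp3, gp4, gp5, gp6, gp7, gp8, gp9, gp10, gp11]
  ring

lemma c12_6 : cE 12 6 x y z = (110880) * (qq x y z ^ 3) + (924) * (G6 x y z) := by
  have h1 := gr_pow_fib 5
  have h2 := gm_pow_fib 5
  norm_num at h1 h2
  have h3 : Nat.choose 12 6 = 924 := by 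
      rw [Nat.choose_eq_descFactorial_div_factorial]; decide +kernel
  simp only [cE, U_eq, D_six, G6, G10, qq, h3]
  norm_num [h1, h2]
  ring_nf
  simp only [gp2, gp3, gp4, gp5, gp6, gp7, gp8, gp9, gp10, gp11]
  ring

lemma c12_8 : cE 12 8 x y z = (161700) * (qq x y z ^ 4) + (-924) * (qq x y z * G6 x y z) := by
  have h1 := gr_pow_fib 3
  have h2 := gm_pow_fib 3
  norm_num at h1 h2
  have h3 : Nat.choose 12 8 = 495 := by 
      rw [Nat.choose_eq_descFactorial_div_factorial]; decide +kernel
  simp only [cE, U_eq, V_eight, D_eight, G6, G10, qq, h3]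
  norm_num [h1, h2]
  ring_nf
  simp only [gp2, gp3, gp4, gp5, gp6, gp7, gp8, gp9, gp10, gp11]
  ring

lemma c12_10 : cE 12 10 x y z = (221760) * (qq x y z ^ 5) + (-5544) * (qq x y z ^ 2 * G6 x y z) + (462) * (G10 x y z) := by
  have h1 := gr_pow_fib 1
  have h2 := gm_pow_fib 1
  norm_num at h1 h2
  have h3 : Nat.choose 12 10 = 66 := by 
      rw [Nat.choose_eq_descFactorial_div_factorial]; decide +kernel
  simp only [cE, U_eq, D_ten, G6, G10, qq, h3]
  norm_num [h1, h2]
  ring_nf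
  simp only [gp2, gp3, gp4, gp5, gp6, gp7, gp8, gp9, gp10, gp11]
  ring

lemma c20_0 : cE 20 0 x y z = (1230120) * (1) := by
  have h1 := gr_pow_fib 19
  have h2 := gm_pow_fib 19
  norm_num at h1 h2
  have h3 : Nat.choose 20 0 = 1 := by 
      rw [Nat.choose_eq_descFactorial_div_factorial]; decide +kernel
  simp only [cE, U_eq, V_zero, D_zero, G6, G10, qq, h3]
  norm_num [h1, h2]
  ring

lemma c20_2 : cE 20 2 x y z = (6072400) * (qq x y z) := by
  have h1 := gr_pow_fib 17
  have h2 := gm_pow_fib 17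
  norm_num at h1 h2
  have h3 : Nat.choose 20 2 = 190 := by 
      rw [Nat.choose_eq_descFactorial_div_factorial]; decide +kernel
  simp only [cE, U_eq, V_two, D_two, G6, G10, qq, h3]
  norm_num [h1, h2]
  ring_nf
  simp only [gp2, gp3, gp4, gp5, gp6, gp7, gp8, gp9, gp10, gp11]
  ring

lemma c20_4 : cE 20 4 x y z = (49186440) * (qq x y z ^ 2) := by
  have h1 := gr_pow_fib 15
  have h2 := gm_pow_fib 15
  norm_num at h1 h2
  have h3 : Nat.choose 20 4 = 4845 := by 
      rw [Nat.choose_eq_descFactorial_div_factorial]; decide +kernel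
  simp only [cE, U_eq, V_four, D_four, G6, G10, qq, h3]
  norm_num [h1, h2]
  ring_nf
  simp only [gp2, gp3, gp4, gp5, gp6, gp7, gp8, gp9, gp10, gp11]
  ring

lemma c20_6 : cE 20 6 x y z = (4651200) * (qq x y z ^ 3) + (3410880) * (G6 x y z) := by
  have h1 := gr_pow_fib 13
  have h2 := gm_pow_fib 13
  norm_num at h1 h2
  have h3 : Nat.choose 20 6 = 38760 := by 
      rw [Nat.choose_eq_descFactorial_div_factorial]; decide +kernel
  simp only [cE, U_eq, D_six, G6, G10, qq, h3]
  norm_num [h1, h2]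
  ring_nf
  simp only [gp2, gp3, gp4, gp5, gp6, gp7, gp8, gp9, gp10, gp11]
  ring

lemma c20_8 : cE 20 8 x y z = (-223386800) * (qq x y z ^ 4) + (10346336) * (qq x y z * G6 x y z) := by
  have h1 := gr_pow_fib 11
  have h2 := gm_pow_fib 11
  norm_num at h1 h2
  have h3 : Nat.choose 20 8 = 125970 := by 
      rw [Nat.choose_eq_descFactorial_div_factorial]; decide +kernel
  simp only [cE, U_eq, V_eight, D_eight, G6, G10, qq, h3]
  norm_num [h1, h2]
  ring_nf
  simp only [gp2, gp3, gp4, gp5, gp6, gp7, gp8, gp9, gp10, gp11]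
  ring

lemma c20_10 : cE 20 10 x y z = (620780160) * (qq x y z ^ 5) + (-15519504) * (qq x y z ^ 2 * G6 x y z) + (1847560) * (G10 x y z) := by
  have h1 := gr_pow_fib 9
  have h2 := gm_pow_fib 9
  norm_num at h1 h2
  have h3 : Nat.choose 20 10 = 184756 := by 
      rw [Nat.choose_eq_descFactorial_div_factorial]; decide +kernel
  simp only [cE, U_eq, D_ten, G6, G10, qq, h3]
  norm_num [h1, h2]
  ring_nf
  simp only [gp2, gp3, gp4, gp5, gp6, gp7, gp8, gp9, gp10, gp11]
  ring

lemma c30_0 : cE 30 0 x y z = (1096067820) * (1) := by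
  have h1 := gr_pow_fib 29
  have h2 := gm_pow_fib 29
  norm_num at h1 h2
  have h3 : Nat.choose 30 0 = 1 := by 
      rw [Nat.choose_eq_descFactorial_div_factorial]; decide +kernel
  simp only [cE, U_eq, V_zero, D_zero, G6, G10, qq, h3]
  norm_num [h1, h2]
  ring

lemma c30_2 : cE 30 2 x y z = (1708845300) * (qq x y z) := by
  have h1 := gr_pow_fib 27
  have h2 := gm_pow_fib 27
  norm_num at h1 h2
  have h3 : Nat.choose 30 2 = 435 := by 
      rw [Nat.choose_eq_descFactorial_div_factorial]; decide +kernel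
  simp only [cE, U_eq, V_two, D_two, G6, G10, qq, h3]
  norm_num [h1, h2]
  ring_nf
  simp only [gp2, gp3, gp4, gp5, gp6, gp7, gp8, gp9, gp10, gp11]
  ring

lemma c30_4 : cE 30 4 x y z = (34097849100) * (qq x y z ^ 2) := by
  have h1 := gr_pow_fib 25
  have h2 := gm_pow_fib 25
  norm_num at h1 h2
  have h3 : Nat.choose 30 4 = 27405 := by 
      rw [Nat.choose_eq_descFactorial_div_factorial]; decide +kernel
  simp only [cE, U_eq, V_four, D_four, G6, G10, qq, h3]
  norm_num [h1, h2]
  ring_nf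
  simp only [gp2, gp3, gp4, gp5, gp6, gp7, gp8, gp9, gp10, gp11]
  ring

lemma c30_6 : cE 30 6 x y z = (71253000) * (qq x y z ^ 3) + (6498867375) * (G6 x y z) := by
  have h1 := gr_pow_fib 23
  have h2 := gm_pow_fib 23
  norm_num at h1 h2
  have h3 : Nat.choose 30 6 = 593775 := by 
      rw [Nat.choose_eq_descFactorial_div_factorial]; decide +kernel
  simp only [cE, U_eq, D_six, G6, G10, qq, h3]
  norm_num [h1, h2]
  ring_nf
  simp only [gp2, gp3, gp4, gp5, gp6, gp7, gp8, gp9, gp10, gp11]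
  ring

lemma c30_8 : cE 30 8 x y z = (-1575724468500) * (qq x y z ^ 4) + (63094531500) * (qq x y z * G6 x y z) := by
  have h1 := gr_pow_fib 21
  have h2 := gm_pow_fib 21
  norm_num at h1 h2
  have h3 : Nat.choose 30 8 = 5852925 := by 
      rw [Nat.choose_eq_descFactorial_div_factorial]; decide +kernel
  simp only [cE, U_eq, V_eight, D_eight, G6, G10, qq, h3]
  norm_num [h1, h2]
  ring_nf
  simp only [gp2, gp3, gp4, gp5, gp6, gp7, gp8, gp9, gp10, gp11]
  ring

lemma c30_10 : cE 30 10 x y z = (100951250400) * (qq x y z ^ 5) + (-2523781260) * (qq x y z ^ 2 * G6 x y z) + (18477684225) * (G10 x y z) := by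
  have h1 := gr_pow_fib 19
  have h2 := gm_pow_fib 19
  norm_num at h1 h2
  have h3 : Nat.choose 30 10 = 30045015 := by 
      rw [Nat.choose_eq_descFactorial_div_factorial]; decide +kernel
  simp only [cE, U_eq, D_ten, G6, G10, qq, h3]
  norm_num [h1, h2]
  ring_nf
  simp only [gp2, gp3, gp4, gp5, gp6, gp7, gp8, gp9, gp10, gp11]
  ring

end

abbrev R3 := MvPolynomial (Fin 3) ℝ

/-- linear form of the tail of a root -/
noncomputable def ln (p : Fin 4 → ℝ) : R3 := C (p 1) * X 0 + C (p 2) * X 1 + C (p 3) * X 2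

noncomputable def MP (b : List Vc) (j : ℕ) : R3 := (b.map fun p => ln (evv p) ^ j).sum

lemma eval_ln (p : Fin 4 → ℝ) (v : Fin 3 → ℝ) :
    eval v (ln p) = p 1 * v 0 + p 2 * v 1 + p 3 * v 2 := by simp [ln]

lemma eval_MP (b : List Vc) (j : ℕ) (v : Fin 3 → ℝ) :
    eval v (MP b j) = mom b j (v 0) (v 1) (v 2) := by
  rw [MP, map_list_sum, List.map_map, mom]
  congr 1
  refine List.map_congr_left fun p _ => ?_
  simp [eval_ln, evv]

/-- restriction to the formal neighbourhood of the first coordinate point -/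
noncomputable def tht : MvPolynomial (Fin 4) ℝ →ₐ[ℝ] PowerSeries R3 :=
  aeval ![1, PowerSeries.X * PowerSeries.C (X 0), PowerSeries.X * PowerSeries.C (X 1),
    PowerSeries.X * PowerSeries.C (X 2)]

lemma amap (c : ℝ) : algebraMap ℝ (PowerSeries R3) c = PowerSeries.C (C c) := by
  rw [PowerSeries.algebraMap_apply, MvPolynomial.algebraMap_eq]

lemma tht_lf (p : Fin 4 → ℝ) :
    tht (lf p) = PowerSeries.X * PowerSeries.C (ln p) + PowerSeries.C (C (p 0)) := by
  simp [tht, lf, Fin.sum_univ_four, amap, ln]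
  ring

lemma coeff_lin (a b : R3) (k j : ℕ) :
    PowerSeries.coeff j ((PowerSeries.X * PowerSeries.C b + PowerSeries.C a) ^ k) =
      k.choose j * (a ^ (k - j) * b ^ j) := by
  rw [add_pow, map_sum]
  have h : ∀ m, PowerSeries.coeff j ((PowerSeries.X * PowerSeries.C b) ^ m *
      PowerSeries.C a ^ (k - m) * (k.choose m : PowerSeries R3)) =
      if j = m then k.choose j * (a ^ (k - j) * b ^ j) else 0 := by
    intro m
    have : (PowerSeries.X * PowerSeries.C b) ^ m * PowerSeries.C a ^ (k - m) *
        (k.choose m : PowerSeries R3) = PowerSeries.X ^ m *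
          PowerSeries.C (b ^ m * a ^ (k - m) * (k.choose m : R3)) := by
      simp only [map_mul, map_pow, map_natCast]
      ring
    rw [this, PowerSeries.coeff_X_pow_mul', PowerSeries.coeff_C]
    rcases lt_trichotomy j m with h | h | h
    · rw [if_neg (by omega), if_neg (by omega)]
    · subst h; simp; ring
    · rw [if_pos (by omega), if_neg (by omega), if_neg (by omega)]
  simp only [h]
  rw [Finset.sum_ite_eq]
  split_ifs with h
  · rfl
  · have : k < j := by simpa using h
    rw [Nat.choose_eq_zero_of_lt this]; simp

lemma coeff_EE (k j : ℕ) (hj : j < k) (v : Fin 3 → ℝ) :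
    eval v (PowerSeries.coeff j (tht (EE k))) = cE k j (v 0) (v 1) (v 2) := by
  have h1 := sum_rts (fun g => k.choose j * ev g ^ (k - j)) j (v 0) (v 1) (v 2)
  have h2 : eval v (PowerSeries.coeff j (tht (EE k))) =
      ∑ a : Fin 60, (k.choose j * ev (rts.get a).1 ^ (k - j) * (ev (rts.get a).2.1 * v 0 +
        ev (rts.get a).2.2.1 * v 1 + ev (rts.get a).2.2.2 * v 2) ^ j) := by
    rw [EE, map_sum, map_sum, map_sum]
    refine Finset.sum_congr rfl fun a _ => ?_
    rw [map_pow, tht_lf, coeff_lin]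
    simp [eval_ln, Pt, evv]
    ring
  rw [h2]
  have h3 : ∀ f : Vc → ℝ, ∑ a : Fin 60, f (rts.get a) = (rts.map f).sum := by
    intro f
    have := Fin.sum_univ_getElem (rts.map f)
    simp only [List.getElem_map] at this
    rw [← this]
    rfl
  rw [h3 (fun p => k.choose j * ev p.1 ^ (k - j) * (ev p.2.1 * v 0 +
        ev p.2.2.1 * v 1 + ev p.2.2.2 * v 2) ^ j), h1, cE]
  have e2 : ev g2 = 2 := by simp [ev, g2]
  have ef : ev gf = gr := by simp [ev, gf]
  have eo : ev go = 1 := by simp [ev, go]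
  have et : ev gt = gr - 1 := by simp [ev, gt]; ring
  rw [e2, ef, eo, et, ev_zero, zero_pow (show k - j ≠ 0 by omega)]
  ring

lemma tht_xq : tht xq = 1 + PowerSeries.X ^ 2 * PowerSeries.C (X 0 ^ 2 + X 1 ^ 2 + X 2 ^ 2) := by
  simp [tht, xq, Fin.sum_univ_four]
  ring

section
variable {A : Type*} [CommRing A] (s q g h Y Z T E12 E20 E30 r12 r20 r30 rY rZ rT : A)

def pY : A := 10 * s ^ 2 * q - 300 * s ^ 4 * q ^ 2 - 44 * s ^ 6 * g + 29000 * s ^ 6 * q ^ 3 + 440 * s ^ 8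
      * q * g - 250000 * s ^ 8 * q ^ 4 - 22 * s ^ 10 * h + 26400 * s ^ 10 * q ^ 2 * g - 10350000
      * s ^ 10 * q ^ 5
def pZ : A := 100 * s ^ 4 * q ^ 2 - 20 * s ^ 6 * g + 5000 * s ^ 6 * q ^ 3 + 920 * s ^ 8 * q * g - 350000
      * s ^ 8 * q ^ 4 + 180 * s ^ 10 * h - 242800 * s ^ 10 * q ^ 2 * g + 97800000 * s ^ 10 * q ^
      5
def pT : A := 1000 * s ^ 6 * q ^ 3 - 300 * s ^ 8 * q * g + 75000 * s ^ 8 * q ^ 4 + 135 * s ^ 10 * h -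
      145200 * s ^ 10 * q ^ 2 * g + 58245000 * s ^ 10 * q ^ 5

lemma expY (h12 : E12 = 7980 + 462000 * s ^ 2 * q + 12474000 * s ^ 4 * q ^ 2 + 73920 * s ^ 6 * g + 110880000 * s ^
      6 * q ^ 3 - 739200 * s ^ 8 * q * g + 1617000000 * s ^ 8 * q ^ 4 + 36960 * s ^ 10 * h -
      44352000 * s ^ 10 * q ^ 2 * g + 22176000000 * s ^ 10 * q ^ 5 + s ^ 11 * r12)
    (hY : 1680 * Y = 7980 * (1 + s ^ 2 * (10 * q)) ^ 6 - E12) :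
    s ^ 11 ∣ 1680 * (Y - pY s q g h) := by
  refine ⟨-r12 + (7980000000 * s * q ^ 6), ?_⟩
  rw [pY]
  linear_combination hY - h12

lemma expZ (h20 : E20 = 1230120 + 60724000 * s ^ 2 * q + 4918644000 * s ^ 4 * q ^ 2 + 272870400 * s ^ 6 * g +
      4651200000 * s ^ 6 * q ^ 3 + 8277068800 * s ^ 8 * q * g - 2233868000000 * s ^ 8 * q ^ 4 +
      147804800 * s ^ 10 * h - 124156032000 * s ^ 10 * q ^ 2 * g + 62078016000000 * s ^ 10 * q ^
      5 + s ^ 11 * r20)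
    (hY : Y = pY s q g h + s ^ 11 * rY)
    (hZ : 59840 * Z = E20 + 6228800 * Y * (1 + s ^ 2 * (10 * q)) ^ 4 - 1230120 * (1 + s ^ 2 * (10 * q)) ^ 10) :
    s ^ 11 ∣ 59840 * (Z - pZ s q g h) := by
  refine ⟨r20 + 6228800 * rY * (1 + s ^ 2 * (10 * q)) ^ 4 +
    (-5481344000 * s * q * h + 7125747200000 * s * q ^ 3 * g - 3067514000000000 * s * q ^ 6 -
      82220160000 * s ^ 3 * q ^ 2 * h + 106886208000000 * s ^ 3 * q ^ 4 * g - 44579440000000000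
      * s ^ 3 * q ^ 7 - 548134400000 * s ^ 5 * q ^ 3 * h + 685168000000000 * s ^ 5 * q ^ 5 * g -
      278979860000000000 * s ^ 5 * q ^ 8 - 1370336000000 * s ^ 7 * q ^ 4 * h + 1644403200000000
      * s ^ 7 * q ^ 6 * g - 656982000000000000 * s ^ 7 * q ^ 9 - 12301200000000000 * s ^ 9 * q ^
      10), ?_⟩
  rw [pY] at hY
  rw [pZ]
  linear_combination hZ + h20 + 6228800 * (1 + s ^ 2 * (10 * q)) ^ 4 * hY

lemma expT (h30 : E30 = 1096067820 + 17088453000 * s ^ 2 * q + 3409784910000 * s ^ 4 * q ^ 2 + 519909390000 * s ^ 6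
      * g + 71253000000 * s ^ 6 * q ^ 3 + 50475625200000 * s ^ 8 * q * g - 15757244685000000 * s
      ^ 8 * q ^ 4 + 1478214738000 * s ^ 10 * h - 20190250080000 * s ^ 10 * q ^ 2 * g +
      10095125040000000 * s ^ 10 * q ^ 5 + s ^ 11 * r30)
    (hY : Y = pY s q g h + s ^ 11 * rY) (hZ : Z = pZ s q g h + s ^ 11 * rZ)
    (hT : 4804800 * T = -E30 + 6415308900 * Z * (1 + s ^ 2 * (10 * q)) ^ 5 + 988451100 * Y ^ 2 * (1 + s ^ 2 * (10 * q)) ^ 3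
      - 14732172000 * Y * (1 + s ^ 2 * (10 * q)) ^ 9 + 1096067820 * (1 + s ^ 2 * (10 * q)) ^ 15) :
    s ^ 11 ∣ 4804800 * (T - pT s q g h) := by
  obtain ⟨k, hk⟩ : ∃ k, 4804800 * pT s q g h = -(1096067820 + 17088453000 * s ^ 2 * q + 3409784910000 * s ^ 4 * q ^ 2 + 519909390000 * s ^ 6
      * g + 71253000000 * s ^ 6 * q ^ 3 + 50475625200000 * s ^ 8 * q * g - 15757244685000000 * s
      ^ 8 * q ^ 4 + 1478214738000 * s ^ 10 * h - 20190250080000 * s ^ 10 * q ^ 2 * g +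
      10095125040000000 * s ^ 10 * q ^ 5) +
      6415308900 * pZ s q g h * (1 + s ^ 2 * (10 * q)) ^ 5 + 988451100 * pY s q g h ^ 2 * (1 + s ^ 2 * (10 * q)) ^ 3
      - 14732172000 * pY s q g h * (1 + s ^ 2 * (10 * q)) ^ 9 + 1096067820 * (1 + s ^ 2 * (10 * q)) ^ 15 - s ^ 11 * k := by
    refine ⟨1913641329600 * s * g ^ 2 + 86472562176000 * s * q * h - 78630843891600000 * s * q ^ 3 * g
      + 30074527692300000000 * s * q ^ 6 + 19136413296000 * s ^ 3 * q * g ^ 2 + 2321543624400000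
      * s ^ 3 * q ^ 2 * h - 2659891502268000000 * s ^ 3 * q ^ 4 * g + 1049532916419000000000 * s
      ^ 3 * q ^ 7 + 1913641329600 * s ^ 5 * g * h - 2679097861440000 * s ^ 5 * q ^ 2 * g ^ 2 +
      37772297362800000 * s ^ 5 * q ^ 3 * h - 45472078131480000000 * s ^ 5 * q ^ 5 * g +
      18687220882200000000000 * s ^ 5 * q ^ 8 + 38272826592000 * s ^ 7 * q * g * h -
      49754674569600000 * s ^ 7 * q ^ 3 * g ^ 2 + 442627989804000000 * s ^ 7 * q ^ 4 * h -
      543595218566400000000 * s ^ 7 * q ^ 6 * g + 228215887208400000000000 * s ^ 7 * q ^ 9 +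
      478410332400 * s ^ 9 * h ^ 2 - 1148184797760000 * s ^ 9 * q ^ 2 * g * h +
      708047291952000000 * s ^ 9 * q ^ 4 * g ^ 2 + 4610231605980000000 * s ^ 9 * q ^ 5 * h -
      5878881003996000000000 * s ^ 9 * q ^ 7 * g + 2267952715378350000000000 * s ^ 9 * q ^ 10 +
      14352309972000 * s ^ 11 * q * h ^ 2 - 38272826592000000 * s ^ 11 * q ^ 3 * g * h +
      25451429683680000000 * s ^ 11 * q ^ 5 * g ^ 2 + 42729897810600000000 * s ^ 11 * q ^ 6 * h
      - 55044081172080000000000 * s ^ 11 * q ^ 8 * g + 18083110956592500000000000 * s ^ 11 * q ^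
      11 + 143523099720000 * s ^ 13 * q ^ 2 * h ^ 2 - 363591852624000000 * s ^ 13 * q ^ 4 * g *
      h + 229636959552000000000 * s ^ 13 * q ^ 6 * g ^ 2 + 262593953622000000000 * s ^ 13 * q ^
      7 * h - 329301281509200000000000 * s ^ 13 * q ^ 9 * g + 95159129772525000000000000 * s ^
      13 * q ^ 12 + 478410332400000 * s ^ 15 * q ^ 3 * h ^ 2 - 1148184797760000000 * s ^ 15 * q
      ^ 5 * g * h + 688910878656000000000 * s ^ 15 * q ^ 7 * g ^ 2 + 741837636540000000000 * s ^
      15 * q ^ 8 * h - 896687319528000000000000 * s ^ 15 * q ^ 10 * g +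
      247949449350750000000000000 * s ^ 15 * q ^ 13 + 324107784000000000000 * s ^ 17 * q ^ 9 * h
      - 388929340800000000000000 * s ^ 17 * q ^ 11 * g + 154122081930000000000000000 * s ^ 17 *
      q ^ 14 + 1096067820000000000000000 * s ^ 19 * q ^ 15, ?_⟩
    rw [pY, pZ, pT]
    ring
  refine ⟨-r30 + 6415308900 * rZ * (1 + s ^ 2 * (10 * q)) ^ 5 + 988451100 * rY * (Y + pY s q g h) * (1 + s ^ 2 * (10 * q)) ^ 3
    - 14732172000 * rY * (1 + s ^ 2 * (10 * q)) ^ 9 + k, ?_⟩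
  linear_combination hT - h30 - hk + 6415308900 * (1 + s ^ 2 * (10 * q)) ^ 5 * hZ + (988451100 * (1 + s ^ 2 * (10 * q)) ^ 3 * (Y + pY s q g h)
    - 14732172000 * (1 + s ^ 2 * (10 * q)) ^ 9) * hY

lemma expb (hY : Y = pY s q g h + s ^ 11 * rY) (hZ : Z = pZ s q g h + s ^ 11 * rZ) :
    s ^ 7 ∣ Z * (1 + s ^ 2 * (10 * q)) ^ 2 - Y ^ 2 - s ^ 6 * (-20 * g + 13000 * q ^ 3) := by
  obtain ⟨k, hk⟩ : ∃ k, pZ s q g h * (1 + s ^ 2 * (10 * q)) ^ 2 - pY s q g h ^ 2 =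
      s ^ 6 * (-20 * g + 13000 * q ^ 3) + s ^ 7 * k := by
    refine ⟨1400 * s * q * g - 910000 * s * q ^ 4 + 180 * s ^ 3 * h - 261600 * s ^ 3 * q ^ 2 * g +
      113700000 * s ^ 3 * q ^ 5 - 1936 * s ^ 5 * g ^ 2 + 4040 * s ^ 5 * q * h - 2476000 * s ^ 5
      * q ^ 3 * g + 1137000000 * s ^ 5 * q ^ 6 + 38720 * s ^ 7 * q * g ^ 2 + 4800 * s ^ 7 * q ^
      2 * h - 55960000 * s ^ 7 * q ^ 4 * g + 18070000000 * s ^ 7 * q ^ 7 - 1936 * s ^ 9 * g * h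
      + 2129600 * s ^ 9 * q ^ 2 * g ^ 2 + 1276000 * s ^ 9 * q ^ 3 * h - 2222000000 * s ^ 9 * q ^
      5 * g + 537800000000 * s ^ 9 * q ^ 8 + 19360 * s ^ 11 * q * g * h - 23232000 * s ^ 11 * q
      ^ 3 * g ^ 2 - 11000000 * s ^ 11 * q ^ 4 * h + 22308000000 * s ^ 11 * q ^ 6 * g -
      5175000000000 * s ^ 11 * q ^ 9 - 484 * s ^ 13 * h ^ 2 + 1161600 * s ^ 13 * q ^ 2 * g * h -
      696960000 * s ^ 13 * q ^ 4 * g ^ 2 - 455400000 * s ^ 13 * q ^ 5 * h + 546480000000 * s ^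
      13 * q ^ 7 * g - 107122500000000 * s ^ 13 * q ^ 10, ?_⟩
    rw [pY, pZ]
    ring
  refine ⟨s ^ 4 * (rZ * (1 + s ^ 2 * (10 * q)) ^ 2 - rY * (Y + pY s q g h)) + k, ?_⟩
  linear_combination hk + (1 + s ^ 2 * (10 * q)) ^ 2 * hZ - (Y + pY s q g h) * hY

set_option maxHeartbeats 4000000 in
lemma expa (hY : Y = pY s q g h + s ^ 11 * rY) (hZ : Z = pZ s q g h + s ^ 11 * rZ)
    (hT : T = pT s q g h + s ^ 11 * rT) :
    s ^ 11 ∣ 2 * (T * (1 + s ^ 2 * (10 * q)) ^ 3) + Y ^ 3 - 3 * Y * (Z * (1 + s ^ 2 * (10 * q)) ^ 2) - s ^ 10 * (270 * h - 342000 * q ^ 2 * g + 137790000 * q ^ 5) := by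
  obtain ⟨k, hk⟩ : ∃ k, 2 * (pT s q g h * (1 + s ^ 2 * (10 * q)) ^ 3) + pY s q g h ^ 3 -
      3 * pY s q g h * (pZ s q g h * (1 + s ^ 2 * (10 * q)) ^ 2) = s ^ 10 * (270 * h - 342000 * q ^ 2 * g + 137790000 * q ^ 5) + s ^ 11 * k := by
    refine ⟨-2640 * s * g ^ 2 + 2700 * s * q * h + 1824000 * s * q ^ 3 * g - 571300000 * s * q ^ 6 +
      153120 * s ^ 3 * q * g ^ 2 + 135000 * s ^ 3 * q ^ 2 * h - 346080000 * s ^ 3 * q ^ 4 * g +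
      123327000000 * s ^ 3 * q ^ 7 + 22440 * s ^ 5 * g * h - 31891200 * s ^ 5 * q ^ 2 * g ^ 2 -
      11832000 * s ^ 5 * q ^ 3 * h + 30796200000 * s ^ 5 * q ^ 5 * g - 7426860000000 * s ^ 5 * q
      ^ 8 - 85184 * s ^ 7 * g ^ 3 + 330000 * s ^ 7 * q * g * h - 231792000 * s ^ 7 * q ^ 3 * g ^
      2 - 222060000 * s ^ 7 * q ^ 4 * h + 311034000000 * s ^ 7 * q ^ 6 * g - 78791500000000 * s
      ^ 7 * q ^ 9 + 11880 * s ^ 9 * h ^ 2 + 2555520 * s ^ 9 * q * g ^ 3 - 33897600 * s ^ 9 * q ^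
      2 * g * h + 18807360000 * s ^ 9 * q ^ 4 * g ^ 2 + 14227200000 * s ^ 9 * q ^ 5 * h -
      16611000000000 * s ^ 9 * q ^ 7 * g + 3433275000000000 * s ^ 9 * q ^ 10 - 127776 * s ^ 11 *
      g ^ 2 * h + 252120 * s ^ 11 * q * h ^ 2 + 127776000 * s ^ 11 * q ^ 2 * g ^ 3 - 472296000 *
      s ^ 11 * q ^ 3 * g * h + 193010400000 * s ^ 11 * q ^ 5 * g ^ 2 + 200322000000 * s ^ 11 * q
      ^ 6 * h - 209045400000000 * s ^ 11 * q ^ 8 * g + 44862675000000000 * s ^ 11 * q ^ 11 +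
      2555520 * s ^ 13 * q * g ^ 2 * h + 752400 * s ^ 13 * q ^ 2 * h ^ 2 - 2981440000 * s ^ 13 *
      q ^ 3 * g ^ 3 - 5118960000 * s ^ 13 * q ^ 4 * g * h + 6116352000000 * s ^ 13 * q ^ 6 * g ^
      2 + 1751520000000 * s ^ 13 * q ^ 7 * h - 3578034000000000 * s ^ 13 * q ^ 9 * g +
      641858750000000000 * s ^ 13 * q ^ 12 - 63888 * s ^ 15 * g * h ^ 2 + 140553600 * s ^ 15 * q
      ^ 2 * g ^ 2 * h + 42108000 * s ^ 15 * q ^ 3 * h ^ 2 - 76665600000 * s ^ 15 * q ^ 4 * g ^ 3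
      - 146652000000 * s ^ 15 * q ^ 5 * g * h + 109335600000000 * s ^ 15 * q ^ 7 * g ^ 2 +
      35494800000000 * s ^ 15 * q ^ 8 * h - 49902930000000000 * s ^ 15 * q ^ 10 * g +
      7379032500000000000 * s ^ 15 * q ^ 13 + 638880 * s ^ 17 * q * g * h ^ 2 - 1533312000 * s ^
      17 * q ^ 3 * g ^ 2 * h - 363000000 * s ^ 17 * q ^ 4 * h ^ 2 + 919987200000 * s ^ 17 * q ^
      5 * g ^ 3 + 1472328000000 * s ^ 17 * q ^ 6 * g * h - 1244073600000000 * s ^ 17 * q ^ 8 * g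
      ^ 2 - 341550000000000 * s ^ 17 * q ^ 9 * h + 551261700000000000 * s ^ 17 * q ^ 11 * g -
      80341875000000000000 * s ^ 17 * q ^ 14 - 10648 * s ^ 19 * h ^ 3 + 38332800 * s ^ 19 * q ^
      2 * g * h ^ 2 - 45999360000 * s ^ 19 * q ^ 4 * g ^ 2 * h - 15028200000 * s ^ 19 * q ^ 5 *
      h ^ 2 + 18399744000000 * s ^ 19 * q ^ 6 * g ^ 3 + 36067680000000 * s ^ 19 * q ^ 7 * g * h
      - 21640608000000000 * s ^ 19 * q ^ 9 * g ^ 2 - 7070085000000000 * s ^ 19 * q ^ 10 * h +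
      8484102000000000000 * s ^ 19 * q ^ 12 * g - 1108717875000000000000 * s ^ 19 * q ^ 15, ?_⟩
    rw [pY, pZ, pT]
    ring
  refine ⟨2 * rT * (1 + s ^ 2 * (10 * q)) ^ 3 + rY * (Y ^ 2 + Y * pY s q g h + pY s q g h ^ 2)
    - 3 * (1 + s ^ 2 * (10 * q)) ^ 2 * (rY * Z + pY s q g h * rZ) + k, ?_⟩
  linear_combination hk + 2 * (1 + s ^ 2 * (10 * q)) ^ 3 * hT + (Y ^ 2 + Y * pY s q g h + pY s q g h ^ 2
    - 3 * (1 + s ^ 2 * (10 * q)) ^ 2 * Z) * hY - 3 * (1 + s ^ 2 * (10 * q)) ^ 2 * pY s q g h * hZ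
end

noncomputable def qp : R3 := C (1 / 10) * (X 0 ^ 2 + X 1 ^ 2 + X 2 ^ 2)
noncomputable def gp : R3 := C ((3 + 4 * gr) / 80) * MP bV 6
noncomputable def hp : R3 := C ((7 + 11 * gr) / 80) * MP bV 10

lemma eval_qp (v : Fin 3 → ℝ) : qq (v 0) (v 1) (v 2) = 10 * eval v qp := by
  simp [qp, qq]
lemma eval_gp (v : Fin 3 → ℝ) : G6 (v 0) (v 1) (v 2) = 80 * eval v gp := by
  simp [gp, G6, eval_MP]; ring
lemma eval_hp (v : Fin 3 → ℝ) : G10 (v 0) (v 1) (v 2) = 80 * eval v hp := by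
  simp [hp, G10, eval_MP]; ring

lemma trunc (k : ℕ) (hk : 10 < k) (c : Fin 6 → R3)
    (hc : ∀ (i : Fin 6) (v : Fin 3 → ℝ), cE k (2 * (i : ℕ)) (v 0) (v 1) (v 2) = eval v (c i)) :
    ∃ r, tht (EE k) = ∑ i : Fin 6, PowerSeries.X ^ (2 * (i : ℕ)) * PowerSeries.C (c i) +
      PowerSeries.X ^ 11 * r := by
  have h : PowerSeries.X ^ 11 ∣ tht (EE k) -
      ∑ i : Fin 6, PowerSeries.X ^ (2 * (i : ℕ)) * PowerSeries.C (c i) := by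
    rw [PowerSeries.X_pow_dvd_iff]
    intro m hm
    rw [map_sub, sub_eq_zero]
    refine MvPolynomial.funext fun v => ?_
    rw [coeff_EE k m (by omega)]
    have h1 : ∀ i : Fin 6, PowerSeries.coeff m (PowerSeries.X ^ (2 * (i : ℕ)) *
        PowerSeries.C (c i)) = if m = 2 * (i : ℕ) then c i else 0 := by
      intro i
      rw [PowerSeries.coeff_X_pow_mul', PowerSeries.coeff_C]
      split_ifs <;> first | rfl | omega
    rw [map_sum]
    simp only [h1]
    rcases Nat.even_or_odd' m with ⟨j, rfl | rfl⟩
    · have := hc ⟨j, by omega⟩ v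
      rw [this]
      congr 1
      rw [Finset.sum_eq_single (⟨j, by omega⟩ : Fin 6)]
      · simp
      · intro b _ hb
        rw [if_neg]
        intro h
        exact hb (Fin.ext (by simp; omega))
      · simp
    · rw [cE_odd _ _ _ _ _ ⟨j, rfl⟩]
      rw [Finset.sum_eq_zero]
      · simp
      · intro i _
        rw [if_neg (by omega)]
  obtain ⟨r, hr⟩ := h
  exact ⟨r, by rw [← hr]; ring⟩

lemma tE12 : ∃ r, tht (EE 12) = 7980 +
      462000 * (PowerSeries.X : PowerSeries R3) ^ 2 * PowerSeries.C qp +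
      12474000 * (PowerSeries.X : PowerSeries R3) ^ 4 * PowerSeries.C qp ^ 2 +
      73920 * (PowerSeries.X : PowerSeries R3) ^ 6 * PowerSeries.C gp +
      110880000 * (PowerSeries.X : PowerSeries R3) ^ 6 * PowerSeries.C qp ^ 3 -
      739200 * (PowerSeries.X : PowerSeries R3) ^ 8 * PowerSeries.C qp * PowerSeries.C gp +
      1617000000 * (PowerSeries.X : PowerSeries R3) ^ 8 * PowerSeries.C qp ^ 4 +
      36960 * (PowerSeries.X : PowerSeries R3) ^ 10 * PowerSeries.C hp -
      44352000 * (PowerSeries.X : PowerSeries R3) ^ 10 * PowerSeries.C qp ^ 2 * PowerSeries.C gp +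
      22176000000 * (PowerSeries.X : PowerSeries R3) ^ 10 * PowerSeries.C qp ^ 5 +
      PowerSeries.X ^ 11 * r := by
  obtain ⟨r, hr⟩ := trunc 12 (by norm_num) ![7980,
    462000 * qp,
    12474000 * qp ^ 2,
    73920 * gp + 110880000 * qp ^ 3,
    -739200 * qp * gp + 1617000000 * qp ^ 4,
    36960 * hp - 44352000 * qp ^ 2 * gp + 22176000000 * qp ^ 5] (by
    intro i v
    fin_cases i <;>
      simp [c12_0, c12_2, c12_4, c12_6, c12_8, c12_10, eval_qp, eval_gp, eval_hp] <;> ring)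
  refine ⟨r, ?_⟩
  rw [hr]
  simp [Fin.sum_univ_succ]
  simp only [map_ofNat]
  ring

lemma tE20 : ∃ r, tht (EE 20) = 1230120 +
      60724000 * (PowerSeries.X : PowerSeries R3) ^ 2 * PowerSeries.C qp +
      4918644000 * (PowerSeries.X : PowerSeries R3) ^ 4 * PowerSeries.C qp ^ 2 +
      272870400 * (PowerSeries.X : PowerSeries R3) ^ 6 * PowerSeries.C gp +
      4651200000 * (PowerSeries.X : PowerSeries R3) ^ 6 * PowerSeries.C qp ^ 3 +
      8277068800 * (PowerSeries.X : PowerSeries R3) ^ 8 * PowerSeries.C qp * PowerSeries.C gp -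
      2233868000000 * (PowerSeries.X : PowerSeries R3) ^ 8 * PowerSeries.C qp ^ 4 +
      147804800 * (PowerSeries.X : PowerSeries R3) ^ 10 * PowerSeries.C hp -
      124156032000 * (PowerSeries.X : PowerSeries R3) ^ 10 * PowerSeries.C qp ^ 2 * PowerSeries.C gp +
      62078016000000 * (PowerSeries.X : PowerSeries R3) ^ 10 * PowerSeries.C qp ^ 5 +
      PowerSeries.X ^ 11 * r := by
  obtain ⟨r, hr⟩ := trunc 20 (by norm_num) ![1230120,
    60724000 * qp,
    4918644000 * qp ^ 2,
    272870400 * gp + 4651200000 * qp ^ 3,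
    8277068800 * qp * gp - 2233868000000 * qp ^ 4,
    147804800 * hp - 124156032000 * qp ^ 2 * gp + 62078016000000 * qp ^ 5] (by
    intro i v
    fin_cases i <;>
      simp [c20_0, c20_2, c20_4, c20_6, c20_8, c20_10, eval_qp, eval_gp, eval_hp] <;> ring)
  refine ⟨r, ?_⟩
  rw [hr]
  simp [Fin.sum_univ_succ]
  simp only [map_ofNat]
  ring

lemma tE30 : ∃ r, tht (EE 30) = 1096067820 +
      17088453000 * (PowerSeries.X : PowerSeries R3) ^ 2 * PowerSeries.C qp +
      3409784910000 * (PowerSeries.X : PowerSeries R3) ^ 4 * PowerSeries.C qp ^ 2 +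
      519909390000 * (PowerSeries.X : PowerSeries R3) ^ 6 * PowerSeries.C gp +
      71253000000 * (PowerSeries.X : PowerSeries R3) ^ 6 * PowerSeries.C qp ^ 3 +
      50475625200000 * (PowerSeries.X : PowerSeries R3) ^ 8 * PowerSeries.C qp * PowerSeries.C gp -
      15757244685000000 * (PowerSeries.X : PowerSeries R3) ^ 8 * PowerSeries.C qp ^ 4 +
      1478214738000 * (PowerSeries.X : PowerSeries R3) ^ 10 * PowerSeries.C hp -
      20190250080000 * (PowerSeries.X : PowerSeries R3) ^ 10 * PowerSeries.C qp ^ 2 * PowerSeries.C gp +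
      10095125040000000 * (PowerSeries.X : PowerSeries R3) ^ 10 * PowerSeries.C qp ^ 5 +
      PowerSeries.X ^ 11 * r := by
  obtain ⟨r, hr⟩ := trunc 30 (by norm_num) ![1096067820,
    17088453000 * qp,
    3409784910000 * qp ^ 2,
    519909390000 * gp + 71253000000 * qp ^ 3,
    50475625200000 * qp * gp - 15757244685000000 * qp ^ 4,
    1478214738000 * hp - 20190250080000 * qp ^ 2 * gp + 10095125040000000 * qp ^ 5] (by
    intro i v
    fin_cases i <;>
      simp [c30_0, c30_2, c30_4, c30_6, c30_8, c30_10, eval_qp, eval_gp, eval_hp] <;> ring)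
  refine ⟨r, ?_⟩
  rw [hr]
  simp [Fin.sum_univ_succ]
  simp only [map_ofNat]
  ring

noncomputable def YY : MvPolynomial (Fin 4) ℝ := C (1 / 1680) * (7980 * xq ^ 6 - EE 12)
noncomputable def ZZ : MvPolynomial (Fin 4) ℝ :=
  C (1 / 59840) * (EE 20 + 6228800 * YY * xq ^ 4 - 1230120 * xq ^ 10)
noncomputable def TT : MvPolynomial (Fin 4) ℝ :=
  C (1 / 4804800) * (-EE 30 + 6415308900 * ZZ * xq ^ 5 + 988451100 * YY ^ 2 * xq ^ 3
      - 14732172000 * YY * xq ^ 9 + 1096067820 * xq ^ 15)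

lemma YY_eq : 1680 * YY = 7980 * xq ^ 6 - EE 12 := by
  have h : (1680 : MvPolynomial (Fin 4) ℝ) * C (1 / 1680) = 1 := by
    rw [← map_ofNat C 1680, ← C_mul]; norm_num
  rw [YY, ← mul_assoc, h, one_mul]

lemma ZZ_eq : 59840 * ZZ = EE 20 + 6228800 * YY * xq ^ 4 - 1230120 * xq ^ 10 := by
  have h : (59840 : MvPolynomial (Fin 4) ℝ) * C (1 / 59840) = 1 := by
    rw [← map_ofNat C 59840, ← C_mul]; norm_num
  rw [ZZ, ← mul_assoc, h, one_mul]

lemma TT_eq : 4804800 * TT = -EE 30 + 6415308900 * ZZ * xq ^ 5 + 988451100 * YY ^ 2 * xq ^ 3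
      - 14732172000 * YY * xq ^ 9 + 1096067820 * xq ^ 15 := by
  have h : (4804800 : MvPolynomial (Fin 4) ℝ) * C (1 / 4804800) = 1 := by
    rw [← map_ofNat C 4804800, ← C_mul]; norm_num
  rw [TT, ← mul_assoc, h, one_mul]

/-- normalized generators -/
noncomputable def kk : Fin 4 → MvPolynomial (Fin 4) ℝ := ![xq, YY, ZZ, TT]

noncomputable def ee : Fin 4 → MvPolynomial (Fin 4) ℝ :=
  ![X 0, 7980 * X 0 ^ 6 - 1680 * X 1,
    59840 * X 2 - 6228800 * (X 1 * X 0 ^ 4) + 1230120 * X 0 ^ 10,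
    -4804800 * X 3 + 6415308900 * (X 2 * X 0 ^ 5) + 988451100 * (X 1 ^ 2 * X 0 ^ 3)
      - 14732172000 * (X 1 * X 0 ^ 9) + 1096067820 * X 0 ^ 15]

lemma kk_ee (i : Fin 4) : aeval kk (ee i) = hgen i := by
  have h1 := YY_eq
  have h2 := ZZ_eq
  have h3 := TT_eq
  fin_cases i
  · simp [kk, ee, hgen]
  · simp [kk, ee, hgen]
    simp only [map_ofNat]
    linear_combination -h1
  · simp [kk, ee, hgen]
    simp only [map_ofNat]
    linear_combination h2
  · simp [kk, ee, hgen]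
    simp only [map_ofNat]
    linear_combination -h3

lemma wh_num (n : ℕ) [n.AtLeastTwo] {f : MvPolynomial (Fin 4) ℝ} {d : ℕ}
    (hf : IsWeightedHomogeneous dg f d) :
    IsWeightedHomogeneous dg ((OfNat.ofNat n : MvPolynomial (Fin 4) ℝ) * f) d := by
  rw [← map_ofNat C n]
  simpa using (isWeightedHomogeneous_C dg (OfNat.ofNat n : ℝ)).mul hf

lemma wh_sub {f g : MvPolynomial (Fin 4) ℝ} {d : ℕ} (hf : IsWeightedHomogeneous dg f d)
    (hg : IsWeightedHomogeneous dg g d) : IsWeightedHomogeneous dg (f - g) d :=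
  (weightedHomogeneousSubmodule ℝ dg d).sub_mem hf hg

lemma wh_X (i : Fin 4) : IsWeightedHomogeneous dg (X i : MvPolynomial (Fin 4) ℝ) (dg i) :=
  isWeightedHomogeneous_X ℝ dg i

lemma ee_wh (i : Fin 4) : IsWeightedHomogeneous dg (ee i) (dg i) := by
  have x0 : ∀ n : ℕ, IsWeightedHomogeneous dg (X 0 ^ n : MvPolynomial (Fin 4) ℝ) (n * 2) :=
    fun n => (wh_X 0).pow n
  have x1 : IsWeightedHomogeneous dg (X 1 : MvPolynomial (Fin 4) ℝ) 12 := wh_X 1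
  have x2 : IsWeightedHomogeneous dg (X 2 : MvPolynomial (Fin 4) ℝ) 20 := wh_X 2
  have x3 : IsWeightedHomogeneous dg (X 3 : MvPolynomial (Fin 4) ℝ) 30 := wh_X 3
  fin_cases i
  · exact wh_X 0
  · exact wh_sub (wh_num _ (x0 6)) (wh_num _ x1)
  · exact (wh_sub (wh_num _ x2) (wh_num _ (x1.mul (x0 4)))).add (wh_num _ (x0 10))
  · refine (wh_sub (((?_ : IsWeightedHomogeneous dg _ 30).add (wh_num _ (x2.mul (x0 5)))).add
      (wh_num _ ((x1.pow 2).mul (x0 3)))) (wh_num _ (x1.mul (x0 9)))).add (wh_num _ (x0 15))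
    rw [neg_mul]
    exact (weightedHomogeneousSubmodule ℝ dg 30).neg_mem (wh_num _ x3)

lemma canc (n : ℕ) [n.AtLeastTwo] (a f : PowerSeries R3)
    (h : a ∣ (OfNat.ofNat n : PowerSeries R3) * f) : a ∣ f := by
  have hn : (OfNat.ofNat n : ℝ) ≠ 0 := OfNat.ofNat_ne_zero n
  have h1 : algebraMap ℝ (PowerSeries R3) (OfNat.ofNat n)⁻¹ * OfNat.ofNat n = 1 := by
    rw [← map_ofNat (algebraMap ℝ (PowerSeries R3)) n, ← map_mul, inv_mul_cancel₀ hn, map_one]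
  have h2 := h.mul_left (algebraMap ℝ (PowerSeries R3) (OfNat.ofNat n)⁻¹)
  rwa [← mul_assoc, h1, one_mul] at h2

lemma quo (n : ℕ) (f : PowerSeries R3) (c : R3)
    (h : PowerSeries.X ^ (n + 1) ∣ f - PowerSeries.X ^ n * PowerSeries.C c) :
    ∃ r, f = PowerSeries.X ^ n * r ∧ PowerSeries.constantCoeff r = c := by
  obtain ⟨k, hk⟩ := h
  refine ⟨PowerSeries.C c + PowerSeries.X * k, ?_, by simp⟩
  linear_combination hk

lemma exp_all : ∃ y b a : PowerSeries R3, tht YY = PowerSeries.X ^ 2 * y ∧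
    tht ZZ * tht xq ^ 2 - tht YY ^ 2 = PowerSeries.X ^ 6 * b ∧
    2 * (tht TT * tht xq ^ 3) + tht YY ^ 3 - 3 * tht YY * (tht ZZ * tht xq ^ 2) =
      PowerSeries.X ^ 10 * a ∧
    PowerSeries.constantCoeff y = 10 * qp ∧
    PowerSeries.constantCoeff b = -20 * gp + 13000 * qp ^ 3 ∧
    PowerSeries.constantCoeff a = 270 * hp - 342000 * qp ^ 2 * gp + 137790000 * qp ^ 5 := by
  have hx : tht xq = 1 + PowerSeries.X ^ 2 * (10 * PowerSeries.C qp) := by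
    rw [tht_xq]
    congr 2
    rw [← map_ofNat PowerSeries.C 10, ← map_mul]
    congr 1
    rw [qp, ← mul_assoc, ← map_ofNat C 10, ← C_mul]
    norm_num
  obtain ⟨r12, h12⟩ := tE12
  obtain ⟨r20, h20⟩ := tE20
  obtain ⟨r30, h30⟩ := tE30
  have eY := congrArg tht YY_eq
  have eZ := congrArg tht ZZ_eq
  have eT := congrArg tht TT_eq
  simp only [map_mul, map_add, map_sub, map_neg, map_pow, map_ofNat, hx] at eY eZ eT
  obtain ⟨rY, hY⟩ := canc _ _ _ (expY _ _ _ _ _ _ _ h12 eY)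
  rw [sub_eq_iff_eq_add'] at hY
  obtain ⟨rZ, hZ⟩ := canc _ _ _ (expZ _ _ _ _ _ _ _ _ _ h20 hY eZ)
  rw [sub_eq_iff_eq_add'] at hZ
  obtain ⟨rT, hT⟩ := canc _ _ _ (expT _ _ _ _ _ _ _ _ _ _ _ h30 hY hZ eT)
  rw [sub_eq_iff_eq_add'] at hT
  have b1 := expb _ _ _ _ _ _ _ _ hY hZ
  have a1 := expa _ _ _ _ _ _ _ _ _ _ hY hZ hT
  have y1 : PowerSeries.X ^ 3 ∣ tht YY - PowerSeries.X ^ 2 * PowerSeries.C (10 * qp) := by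
    obtain ⟨k, hk⟩ : ∃ k, pY PowerSeries.X (PowerSeries.C qp) (PowerSeries.C gp)
        (PowerSeries.C hp) = PowerSeries.X ^ 2 * (10 * PowerSeries.C qp) +
          PowerSeries.X ^ 3 * k := by
      refine ⟨PowerSeries.X * (fun s q g h : PowerSeries R3 =>
        -300 * q ^ 2 - 44 * s ^ 2 * g + 29000 * s ^ 2 * q ^ 3 + 440 * s ^ 4 * q * g - 250000 * s ^ 4 * q ^ 4 - 22 * s ^ 6 * h + 26400 * s ^ 6 * q ^ 2 * g - 10350000 * s ^ 6 * q ^ 5)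
          PowerSeries.X (PowerSeries.C qp) (PowerSeries.C gp) (PowerSeries.C hp), ?_⟩
      simp only [pY]
      ring
    refine ⟨k + PowerSeries.X ^ 8 * rY, ?_⟩
    rw [hY, hk, map_mul, map_ofNat]
    ring
  obtain ⟨y, hy, hy0⟩ := quo 2 _ _ y1
  obtain ⟨b, hb, hb0⟩ := quo 6 (tht ZZ * tht xq ^ 2 - tht YY ^ 2)
    (-20 * gp + 13000 * qp ^ 3) (by
      rw [hx]
      convert b1 using 3
      simp only [map_mul, map_add, map_sub, map_neg, map_pow, map_ofNat])
  obtain ⟨a, ha, ha0⟩ := quo 10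
    (2 * (tht TT * tht xq ^ 3) + tht YY ^ 3 - 3 * tht YY * (tht ZZ * tht xq ^ 2))
    (270 * hp - 342000 * qp ^ 2 * gp + 137790000 * qp ^ 5) (by
      rw [hx]
      convert a1 using 3
      simp only [map_mul, map_add, map_sub, map_neg, map_pow, map_ofNat])
  exact ⟨y, b, a, hy, hb, ha, hy0, hb0, ha0⟩

def ptx : Vc := (gz, (3, 0), (2, 0), (1, 0))

lemma gdx_ne : gdet3 (gc ptx) (gent bV ptx 5) (gent bV ptx 9) 1 2 3 ≠ (0, 0) := by
  decide +kernel

noncomputable def vx : Fin 3 → ℝ := ![3, 2, 1]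

lemma pderiv_ln (p : Fin 4 → ℝ) (j : Fin 3) : pderiv j (ln p) = C (p j.succ) := by
  fin_cases j <;> simp [ln, pderiv_X]

lemma eval_pderiv_MP (k : ℕ) (j : Fin 3) :
    eval vx (pderiv j (MP bV (k + 1))) = (k + 1) * ev (gent bV ptx k j.succ) := by
  rw [MP, map_list_sum, map_list_sum, ev_gent, ← List.sum_map_mul_left, List.map_map,
    List.map_map]
  congr 1
  refine List.map_congr_left fun p _ => ?_
  simp only [Function.comp, Derivation.leibniz_pow, pderiv_ln, smul_eq_mul, nsmul_eq_mul]
  simp [eval_ln, Fin.sum_univ_four, vx, evv, ptx, ev, gz]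
  left
  ring

noncomputable def ff : Fin 3 → R3 := ![10 * qp, -20 * gp + 13000 * qp ^ 3,
  C (1 / 2) * (270 * hp - 342000 * qp ^ 2 * gp + 137790000 * qp ^ 5)]

lemma ff_det : (Matrix.of fun j i => pderiv j (ff i)).det ≠ 0 := by
  have d1 : (Matrix.of fun j i => pderiv j (ff i)).det =
      C (-27000) * (Matrix.of fun j i => pderiv j (![qp, gp, hp] i)).det := by
    have n : ∀ (m : ℕ) [m.AtLeastTwo] (j : Fin 3), pderiv j (OfNat.ofNat m : R3) = 0 :=
      fun m _ j => by rw [← map_ofNat C m, pderiv_C]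
    have e0 : ∀ j, pderiv j (ff 0) = 10 * pderiv j qp := fun j => by
      simp [ff, n]
    have e1 : ∀ j, pderiv j (ff 1) = -20 * pderiv j gp + 39000 * qp ^ 2 * pderiv j qp := fun j => by
      simp [ff, n]
      ring
    have e2 : ∀ j, pderiv j (ff 2) = C (1 / 2) * (270 * pderiv j hp - 342000 * qp ^ 2 * pderiv j gp
        + (688950000 * qp ^ 4 - 684000 * qp * gp) * pderiv j qp) := fun j => by
      simp [ff, n]
      ring
    have e3 : (C (-27000) : R3) = C (1 / 2) * -54000 := by
      rw [← map_ofNat C 54000, ← C_neg, ← C_mul]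
      norm_num
    rw [e3]
    simp [Matrix.det_fin_three, e0, e1, e2]
    ring
  rw [d1]
  have d2 : eval vx (Matrix.of fun j i => pderiv j (![qp, gp, hp] i)).det ≠ 0 := by
    have q0 : ∀ j, eval vx (pderiv j qp) = 1 / 5 * vx j := fun j => by
      fin_cases j <;> simp [qp, vx, pderiv_X] <;> ring
    have g0 : ∀ j : Fin 3, eval vx (pderiv j gp) =
        (3 + 4 * gr) * (3 / 40) * ev (gent bV ptx 5 j.succ) := fun j => by
      rw [gp, pderiv_C_mul, eval_mul, eval_C, eval_pderiv_MP 5]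
      push_cast
      ring
    have h0 : ∀ j : Fin 3, eval vx (pderiv j hp) =
        (7 + 11 * gr) * (1 / 8) * ev (gent bV ptx 9 j.succ) := fun j => by
      rw [hp, pderiv_C_mul, eval_mul, eval_C, eval_pderiv_MP 9]
      push_cast
      ring
    have key : eval vx (Matrix.of fun j i => pderiv j (![qp, gp, hp] i)).det =
        1 / 5 * ((3 + 4 * gr) * (3 / 40)) * ((7 + 11 * gr) * (1 / 8)) *
        ev (gdet3 (gc ptx) (gent bV ptx 5) (gent bV ptx 9) 1 2 3) := by
      simp only [gdet3, ev_add, ev_sub, ev_mul]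
      have a1 : ev (gc ptx 1) = 3 := by simp [gc, ptx, ev]
      have a2 : ev (gc ptx 2) = 2 := by simp [gc, ptx, ev]
      have a3 : ev (gc ptx 3) = 1 := by simp [gc, ptx, ev]
      have v0 : vx 0 = 3 := rfl
      have v1 : vx 1 = 2 := rfl
      have v2 : vx 2 = 1 := rfl
      rw [a1, a2, a3]
      simp [Matrix.det_fin_three, q0, g0, h0, v0, v1, v2]
      ring
    rw [key]
    have hg : 0 < gr := by rw [gr]; positivity
    refine mul_ne_zero (by positivity) fun h => gdx_ne (ev_inj ?_)
    rw [h]; simp [ev]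
  refine mul_ne_zero (by simp) fun h => d2 (by rw [h, map_zero])

lemma ff_indep (Q : R3) (h : aeval ff Q = 0) : Q = 0 :=
  jac_indep ff ff_det _ Q le_rfl h

lemma rts_type : ∀ a ∈ rts, (∃ i : Fin 4, gc a = fun j => if j = i then g2 else gz) ∨
    (gc a 0 = go ∧ ∀ i : Fin 4, gc a i = go ∨ gc a i = -go) ∨
    (∃ σ : Equiv.Perm (Fin 4), Equiv.Perm.sign σ = 1 ∧
      ∃ e ∈ ([1, -1] : List ℤ), ∃ e1 ∈ ([1, -1] : List ℤ), ∃ e2 ∈ ([1, -1] : List ℤ),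
        gc a = fun i => ![e • gf, e1 • go, e2 • gt, gz] (σ i)) := by
  decide +kernel

lemma hom_smul {G : MvPolynomial (Fin 4) ℝ} {n : ℕ} (hG : G.IsHomogeneous n) (c : ℝ)
    (v : Fin 4 → ℝ) : eval (c • v) G = c ^ n * eval v G := by
  rw [eval_eq, eval_eq, Finset.mul_sum]
  refine Finset.sum_congr rfl fun d hd => ?_
  have h := hG (mem_support_iff.mp hd)
  rw [Finsupp.weight_apply, Finsupp.sum_fintype _ _ (by simp)] at h
  simp only [Pi.one_apply, smul_eq_mul, mul_one] at h
  simp only [Pi.smul_apply, smul_eq_mul, mul_pow, Finset.prod_mul_distrib,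
    Finset.prod_pow_eq_pow_sum]
  have h2 : ∏ i ∈ d.support, v i ^ d i = ∏ i, v i ^ d i :=
    Finset.prod_subset (Finset.subset_univ _) (by
      intro i _ hi; simp at hi; simp [hi])
  have h3 : ∑ i ∈ d.support, d i = ∑ i, d i :=
    Finset.sum_subset (Finset.subset_univ _) (by
      intro i _ hi; simpa using hi)
  rw [h3, h]
  ring

lemma van_pd {F : MvPolynomial (Fin 4) ℝ} {v : Fin 4 → ℝ} {m : ℕ}
    (h : vanishesToOrderR F v (m + 1)) (i : Fin 4) : vanishesToOrderR (pderiv i F) v m := by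
  intro l hl
  exact h (i :: l) (by simpa using hl)

lemma van_smul (c : ℝ) (v : Fin 4 → ℝ) (m : ℕ) : ∀ (d : ℕ) (F : MvPolynomial (Fin 4) ℝ),
    F.IsHomogeneous d → vanishesToOrderR F v m → vanishesToOrderR F (c • v) m := by
  intro d F hF h l hl
  have h1 : ∀ (l : List (Fin 4)) (G : MvPolynomial (Fin 4) ℝ) (n : ℕ), G.IsHomogeneous n →
      ∃ n', (l.foldl (fun G i => pderiv i G) G).IsHomogeneous n' := by
    intro l
    induction l with
    | nil => exact fun G n h => ⟨n, h⟩
    | cons i l ih => exact fun G n h => ih _ _ h.pderiv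
  obtain ⟨n', hn'⟩ := h1 l F d hF
  rw [hom_smul hn', h l hl, mul_zero]

/-- substitution of a formal arc through a point -/
noncomputable def arc (v : Fin 4 → ℝ) (u : Fin 4 → R3) :
    MvPolynomial (Fin 4) ℝ →ₐ[ℝ] PowerSeries R3 :=
  aeval fun i => PowerSeries.C (C (v i)) + PowerSeries.X * PowerSeries.C (u i)

lemma arc_deriv (v : Fin 4 → ℝ) (u : Fin 4 → R3) (F : MvPolynomial (Fin 4) ℝ) :
    PowerSeries.derivative R3 (arc v u F) = ∑ i, PowerSeries.C (u i) * arc v u (pderiv i F) := by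
  induction F using MvPolynomial.induction_on with
  | C c =>
    have : arc v u (C c) = PowerSeries.C (C c) := by
      rw [← MvPolynomial.algebraMap_eq, AlgHom.commutes, amap]
    rw [this]
    simp
  | add p q hp hq => simp only [map_add, hp, hq, mul_add, Finset.sum_add_distrib]
  | mul_X p i hp =>
    have hX : arc v u (X i) = PowerSeries.C (C (v i)) + PowerSeries.X * PowerSeries.C (u i) := by
      rw [arc, aeval_X]
    have hd : PowerSeries.derivative R3 (arc v u (X i)) = PowerSeries.C (u i) := by
      rw [hX, map_add, Derivation.leibniz, PowerSeries.derivative_C, PowerSeries.derivative_C,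
        PowerSeries.derivative_X, smul_zero, zero_add, zero_add, smul_eq_mul, mul_one]
    have hj : ∀ j, PowerSeries.C (u j) * arc v u (pderiv j (p * X i)) =
        (if j = i then PowerSeries.C (u i) * arc v u p else 0) +
          arc v u (X i) * (PowerSeries.C (u j) * arc v u (pderiv j p)) := by
      intro j
      rw [Derivation.leibniz, smul_eq_mul, smul_eq_mul, map_add, map_mul, map_mul]
      split_ifs with h
      · subst h
        rw [pderiv_X_self, map_one]
        ring
      · rw [pderiv_X_of_ne (fun h' => h h'.symm), map_zero]
        ring
    rw [map_mul, Derivation.leibniz, hd, hp, smul_eq_mul, smul_eq_mul]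
    simp only [hj]
    rw [Finset.sum_add_distrib, Finset.sum_ite_eq' Finset.univ i, if_pos (Finset.mem_univ i),
      ← Finset.mul_sum]
    ring

lemma arc_const (v : Fin 4 → ℝ) (u : Fin 4 → R3) (F : MvPolynomial (Fin 4) ℝ) :
    PowerSeries.constantCoeff (arc v u F) = C (eval v F) := by
  induction F using MvPolynomial.induction_on with
  | C c =>
    have : arc v u (C c) = PowerSeries.C (C c) := by
      rw [← MvPolynomial.algebraMap_eq, AlgHom.commutes, amap]
    rw [this]
    simp
  | add p q hp hq => simp only [map_add, hp, hq]
  | mul_X p i hp =>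
    simp only [map_mul, hp]
    simp [arc]

lemma van_arc (v : Fin 4 → ℝ) (u : Fin 4 → R3) (m : ℕ) : ∀ F : MvPolynomial (Fin 4) ℝ,
    vanishesToOrderR F v m → PowerSeries.X ^ m ∣ arc v u F := by
  induction m with
  | zero => intro F _; simp
  | succ m ih =>
    intro F hF
    have h1 : PowerSeries.X ^ m ∣ PowerSeries.derivative R3 (arc v u F) := by
      rw [arc_deriv]
      exact Finset.dvd_sum fun i _ => (ih _ (van_pd hF i)).mul_left _
    rw [PowerSeries.X_pow_dvd_iff] at h1 ⊢
    intro k hk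
    cases k with
    | zero =>
      have := hF [] (by simp)
      simp at this
      rw [PowerSeries.coeff_zero_eq_constantCoeff_apply, arc_const, this, map_zero]
    | succ k =>
      have := h1 k (by omega)
      rw [PowerSeries.coeff_derivative] at this
      have h3 : ((k : R3) + 1) ≠ 0 := by exact_mod_cast Nat.succ_ne_zero k
      exact (mul_eq_zero.mp this).resolve_right h3

lemma cfg_cover {a : Vc} (ha : a ∈ rts) : ∃ c : ℝ, ∃ p ∈ H4Config, evv a = c • p := by
  have hgc : ∀ j, evv a j = ev (gc a j) := fun j => (ev_gc a j).symm
  have e2 : ev g2 = 2 := by simp [ev, g2]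
  have ef : ev gf = gr := by simp [ev, gf]
  have eo : ev go = 1 := by simp [ev, go]
  have et : ev gt = gr⁻¹ := by
    have h0 : gr ≠ 0 := by rw [gr]; positivity
    have : ev gt = gr - 1 := by simp [ev, gt]; ring
    rw [this]
    refine eq_inv_of_mul_eq_one_left ?_
    linear_combination gr_sq
  rcases rts_type a ha with ⟨i, hi⟩ | ⟨h0, h1⟩ | ⟨σ, hσ, e, he, e1, he1, e2', he2, h⟩
  · refine ⟨2, Pi.single i 1, Or.inl (Or.inl ⟨i, rfl⟩), ?_⟩
    ext j
    rw [hgc, hi]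
    by_cases hj : j = i
    · subst hj; simp [e2]
    · simp [hj, ev_zero]
  · refine ⟨1, evv a, Or.inl (Or.inr ⟨?_, ?_⟩), by simp⟩
    · rw [hgc, h0, eo]
    · intro i _
      rw [hgc]
      rcases h1 i with h | h <;> simp [h, ev_neg, eo]
  · have hz : ∀ (n : ℤ) (g : Gd), n ∈ ([1, -1] : List ℤ) → ev (n • g) = n * ev g := by
      intro n g hn
      simp at hn
      rcases hn with rfl | rfl <;> simp [ev_neg]
    have hsq : ∀ n : ℤ, n ∈ ([1, -1] : List ℤ) → (n : ℝ) = 1 ∨ (n : ℝ) = -1 := by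
      intro n hn
      simp at hn
      rcases hn with rfl | rfl <;> simp
    have hee : (e : ℝ) * e = 1 := by rcases hsq e he with h | h <;> rw [h] <;> norm_num
    have hp : ∀ x y : ℝ, (x = 1 ∨ x = -1) → (y = 1 ∨ y = -1) → (x * y = 1 ∨ x * y = -1) := by
      rintro x y (rfl | rfl) (rfl | rfl) <;> norm_num
    refine ⟨e, fun i => ![gr, (e * e1 : ℝ), (e * e2' : ℝ) * gr⁻¹, 0] (σ i),
      Or.inr ⟨σ, hσ, e * e1, e * e2', hp _ _ (hsq e he) (hsq e1 he1),
        hp _ _ (hsq e he) (hsq e2' he2), rfl⟩, ?_⟩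
    ext j
    rw [hgc, h, Pi.smul_apply, smul_eq_mul]
    change ev (![e • gf, e1 • go, e2' • gt, gz] (σ j)) = _
    generalize σ j = k
    fin_cases k
    · simp [-zsmul_eq_mul, hz e _ he, ef]
    · simp [-zsmul_eq_mul, hz e1 _ he1, eo]
      linear_combination -(e1 : ℝ) * hee
    · simp [-zsmul_eq_mul, hz e2' _ he2, et]
      linear_combination -(e2' : ℝ) * gr⁻¹ * hee
    · simp [ev_zero]

lemma van_Phi {F : MvPolynomial (Fin 4) ℝ} {d m : ℕ} (hF : F.IsHomogeneous d)
    (hv : ∀ v ∈ H4Config, vanishesToOrderR F v m) {v : Fin 4 → ℝ} (h : v ∈ PhiR) (c : ℝ) :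
    vanishesToOrderR F (c • v) m := by
  obtain ⟨a, ha, h⟩ := h
  obtain ⟨c', p, hp, h'⟩ := cfg_cover ha
  rcases h with rfl | rfl
  · rw [h', smul_smul]
    exact van_smul _ _ _ _ _ hF (hv p hp)
  · rw [h', ← neg_smul, smul_smul]
    exact van_smul _ _ _ _ _ hF (hv p hp)

abbrev M4 := Matrix (Fin 4) (Fin 4) ℝ

/-- linear substitution -/
noncomputable def act (A : M4) : MvPolynomial (Fin 4) ℝ →ₐ[ℝ] MvPolynomial (Fin 4) ℝ :=
  aeval fun i => ∑ j, C (A i j) * X j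

lemma act_X (A : M4) (i : Fin 4) : act A (X i) = ∑ j, C (A i j) * X j := by simp [act]

lemma act_act (A B : M4) (F : MvPolynomial (Fin 4) ℝ) : act B (act A F) = act (A * B) F := by
  have : (act B).comp (act A) = act (A * B) := by
    refine MvPolynomial.algHom_ext fun i => ?_
    rw [AlgHom.comp_apply, act_X, act_X, map_sum]
    simp only [map_mul, act_X, Matrix.mul_apply, map_sum, Finset.sum_mul, Finset.mul_sum]
    rw [Finset.sum_comm]
    refine Finset.sum_congr rfl fun j _ => Finset.sum_congr rfl fun k _ => ?_
    have : act B (C (A i k)) = C (A i k) := by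
      rw [← MvPolynomial.algebraMap_eq, AlgHom.commutes]
    rw [this]
    ring
  exact DFunLike.congr_fun this F

lemma act_one (F : MvPolynomial (Fin 4) ℝ) : act 1 F = F := by
  have : act 1 = AlgHom.id ℝ _ := by
    refine MvPolynomial.algHom_ext fun i => ?_
    rw [act_X]
    simp [Matrix.one_apply]
  rw [this]; rfl

lemma act_ne (A : M4) (hA : A.det ≠ 0) {F : MvPolynomial (Fin 4) ℝ} (hF : F ≠ 0) : act A F ≠ 0 := by
  intro h
  apply hF
  have h1 := act_act A A⁻¹ F
  rw [Matrix.mul_nonsing_inv A (Ne.isUnit hA), act_one, h, map_zero] at h1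
  exact h1.symm

lemma act_hom (A : M4) {F : MvPolynomial (Fin 4) ℝ} {d : ℕ} (hF : F.IsHomogeneous d) :
    (act A F).IsHomogeneous d := by
  have := hF.aeval (fun i => ∑ j, C (A i j) * X j) (n := 1) fun i =>
    IsHomogeneous.sum _ _ _ fun j _ => isHomogeneous_C_mul_X _ _
  rwa [one_mul] at this

/-- matrix of a reflection -/
noncomputable def rmat (p : Fin 4 → ℝ) : M4 :=
  Matrix.of fun i j => (if i = j then 1 else 0) - p i / 2 * p j

lemma rmat_act (p : Fin 4 → ℝ) (F : MvPolynomial (Fin 4) ℝ) : act (rmat p) F = sg p F := by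
  have : act (rmat p) = sg p := by
    refine MvPolynomial.algHom_ext fun i => ?_
    rw [act_X, sg, aeval_X, lf, Finset.mul_sum]
    simp only [rmat, Matrix.of_apply, map_sub, sub_mul, Finset.sum_sub_distrib]
    congr 1
    · simp
    · exact Finset.sum_congr rfl fun j _ => by rw [C_mul]; ring
  rw [this]

lemma rmat_mulVec (p v : Fin 4 → ℝ) : (rmat p).mulVec v = rfv p v := by
  ext i
  simp only [Matrix.mulVec, dotProduct, rmat, Matrix.of_apply, rfv, sub_mul,
    Finset.sum_sub_distrib]
  congr 1
  · simp
  · rw [Finset.sum_div, Finset.sum_mul]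
    exact Finset.sum_congr rfl fun j _ => by ring

lemma rmat_sq {p : Fin 4 → ℝ} (hp : ∑ j, p j ^ 2 = 4) : rmat p * rmat p = 1 := by
  apply Matrix.toLin'.injective
  refine LinearMap.ext fun v => ?_
  rw [Matrix.toLin'_mul, LinearMap.comp_apply, Matrix.toLin'_apply, Matrix.toLin'_apply,
    rmat_mulVec, rmat_mulVec, rfv_invol hp, Matrix.toLin'_one, LinearMap.id_apply]

def Kset : Set M4 := {A | A.det ≠ 0 ∧ ∀ v ∈ PhiR, A.mulVec v ∈ PhiR}

lemma PhiR_fin : PhiR.Finite := by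
  have : PhiR ⊆ {v | v ∈ rts.map evv} ∪ {v | v ∈ rts.map fun a => - evv a} := by
    rintro v ⟨a, ha, rfl | rfl⟩
    · exact Or.inl (List.mem_map.mpr ⟨a, ha, rfl⟩)
    · exact Or.inr (List.mem_map.mpr ⟨a, ha, rfl⟩)
  exact ((List.finite_toSet _).union (List.finite_toSet _)).subset this

lemma single_mem (i : Fin 4) : (Pi.single i 2 : Fin 4 → ℝ) ∈ PhiR := by
  have h : ∀ i : Fin 4, ∃ a ∈ rts, gc a = fun j => if j = i then g2 else gz := by
    decide +kernel
  obtain ⟨a, ha, h⟩ := h i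
  refine ⟨a, ha, Or.inl ?_⟩
  ext j
  rw [← ev_gc, h]
  by_cases hj : j = i
  · subst hj; simp [ev, g2]
  · simp [hj, ev_zero]

lemma Kset_fin : Kset.Finite := by
  have h1 : (Set.pi Set.univ fun _ : Fin 4 => PhiR).Finite := Set.Finite.pi fun _ => PhiR_fin
  refine Set.Finite.of_finite_image (f := fun A : M4 => fun i => A.mulVec (Pi.single i 2))
    (h1.subset ?_) ?_
  · rintro _ ⟨A, hA, rfl⟩ i _
    exact hA.2 _ (single_mem i)
  · intro A _ B _ h
    ext i j
    have := congrFun (congrFun h j) i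
    simpa using this

lemma Kset_one : (1 : M4) ∈ Kset := ⟨by simp, fun v hv => by simpa using hv⟩

lemma Kset_mul {A : M4} (hA : A ∈ Kset) (j : Fin 4) : A * rmat (evv (smp j)) ∈ Kset := by
  have hs := rmat_sq (evv_norm (smp_mem j))
  refine ⟨?_, fun v hv => ?_⟩
  · rw [Matrix.det_mul]
    refine mul_ne_zero hA.1 fun h => ?_
    have := congrArg Matrix.det hs
    rw [Matrix.det_mul, h] at this
    simp at this
  · rw [← Matrix.mulVec_mulVec, rmat_mulVec]
    exact hA.2 _ (PhiR_rfv j hv)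

noncomputable def Kf : Finset M4 := Kset_fin.toFinset

lemma mem_Kf {A : M4} : A ∈ Kf ↔ A ∈ Kset := by simp [Kf]

lemma Kf_pos : 0 < Kf.card := Finset.card_pos.mpr ⟨1, mem_Kf.mpr Kset_one⟩

/-- the norm of a form -/
noncomputable def NN (F : MvPolynomial (Fin 4) ℝ) : MvPolynomial (Fin 4) ℝ := ∏ A ∈ Kf, act A F

lemma NN_ne {F : MvPolynomial (Fin 4) ℝ} (hF : F ≠ 0) : NN F ≠ 0 :=
  Finset.prod_ne_zero_iff.mpr fun A hA => act_ne A (mem_Kf.mp hA).1 hF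

lemma NN_hom {F : MvPolynomial (Fin 4) ℝ} {d : ℕ} (hF : F.IsHomogeneous d) :
    (NN F).IsHomogeneous (Kf.card * d) := by
  have := IsHomogeneous.prod Kf (fun A => act A F) (fun _ => d) fun A _ => act_hom A hF
  simpa [NN] using this

lemma NN_sg_smp (F : MvPolynomial (Fin 4) ℝ) (j : Fin 4) : sg (evv (smp j)) (NN F) = NN F := by
  have hs := rmat_sq (evv_norm (smp_mem j))
  rw [← rmat_act, NN, map_prod]
  simp only [act_act]
  refine Finset.prod_bij' (fun A _ => A * rmat (evv (smp j))) (fun A _ => A * rmat (evv (smp j)))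
    (fun A hA => mem_Kf.mpr (Kset_mul (mem_Kf.mp hA) j))
    (fun A hA => mem_Kf.mpr (Kset_mul (mem_Kf.mp hA) j)) ?_ ?_ ?_
  · intro A _; rw [Matrix.mul_assoc, hs, Matrix.mul_one]
  · intro A _; rw [Matrix.mul_assoc, hs, Matrix.mul_one]
  · intro A _; rfl

lemma NN_sg (F : MvPolynomial (Fin 4) ℝ) (a : Fin 60) : sg (Pt a) (NN F) = NN F :=
  sg_all (NN_sg_smp F) _ (List.get_mem _ _)

lemma tht_act (A : M4) (F : MvPolynomial (Fin 4) ℝ) :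
    tht (act A F) = arc (A.mulVec (Pi.single 0 1)) (fun i => ln (A i)) F := by
  have : tht.comp (act A) = arc (A.mulVec (Pi.single 0 1)) (fun i => ln (A i)) := by
    refine MvPolynomial.algHom_ext fun i => ?_
    rw [AlgHom.comp_apply, act_X, arc, aeval_X]
    have := tht_lf (A i)
    rw [lf] at this
    rw [this, add_comm]
    simp
  exact DFunLike.congr_fun this F

lemma NN_van {F : MvPolynomial (Fin 4) ℝ} {d m : ℕ} (hF : F.IsHomogeneous d)
    (hv : ∀ v ∈ H4Config, vanishesToOrderR F v m) :
    PowerSeries.X ^ (Kf.card * m) ∣ tht (NN F) := by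
  rw [NN, map_prod, mul_comm, pow_mul, ← Finset.prod_const]
  refine Finset.prod_dvd_prod_of_dvd _ _ fun A hA => ?_
  rw [tht_act]
  apply van_arc
  have h1 : (Pi.single 0 1 : Fin 4 → ℝ) = (1 / 2 : ℝ) • Pi.single 0 2 := by
    rw [← Pi.single_smul]; norm_num
  rw [h1, Matrix.mulVec_smul]
  exact van_Phi hF hv ((mem_Kf.mp hA).2 _ (single_mem 0)) _

/-- dehomogenization of a weighted homogeneous polynomial -/
noncomputable def dh (P : MvPolynomial (Fin 4) ℝ) : R3 :=
  ∑ d ∈ P.support, monomial (Finsupp.tail d) (coeff d P)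

lemma wt_dg {P : MvPolynomial (Fin 4) ℝ} {n : ℕ} (hP : IsWeightedHomogeneous dg P n)
    {d : Fin 4 →₀ ℕ} (hd : d ∈ P.support) : 2 * d 0 + 12 * d 1 + 20 * d 2 + 30 * d 3 = n := by
  have h := hP (mem_support_iff.mp hd)
  rw [Finsupp.weight_apply, Finsupp.sum_fintype _ _ (by simp)] at h
  simp [Fin.sum_univ_four, dg] at h
  omega

lemma tail_inj {P : MvPolynomial (Fin 4) ℝ} {n : ℕ} (hP : IsWeightedHomogeneous dg P n)
    {d d' : Fin 4 →₀ ℕ} (hd : d ∈ P.support) (hd' : d' ∈ P.support)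
    (h : Finsupp.tail d = Finsupp.tail d') : d = d' := by
  have h1 := wt_dg hP hd
  have h2 := wt_dg hP hd'
  have e1 : d 1 = d' 1 := DFunLike.congr_fun h 0
  have e2 : d 2 = d' 2 := DFunLike.congr_fun h 1
  have e3 : d 3 = d' 3 := DFunLike.congr_fun h 2
  ext i
  fin_cases i
  · change d 0 = d' 0; omega
  · exact e1
  · exact e2
  · exact e3

lemma dh_ne {P : MvPolynomial (Fin 4) ℝ} {n : ℕ} (hP : IsWeightedHomogeneous dg P n)
    (h : P ≠ 0) : dh P ≠ 0 := by
  obtain ⟨d, hd⟩ := Finset.nonempty_iff_ne_empty.mpr (fun h' => h (support_eq_empty.mp h'))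
  intro h0
  have h1 := congrArg (coeff (Finsupp.tail d)) h0
  rw [dh, coeff_sum, Finset.sum_eq_single d] at h1
  · rw [coeff_monomial, if_pos rfl, coeff_zero] at h1
    exact mem_support_iff.mp hd h1
  · intro b hb hne
    rw [coeff_monomial, if_neg]
    exact fun h' => hne (tail_inj hP hb hd h')
  · intro h'; exact absurd hd h'

lemma dh_supp (P : MvPolynomial (Fin 4) ℝ) {e : Fin 3 →₀ ℕ} (he : e ∈ (dh P).support) :
    ∃ d ∈ P.support, e = Finsupp.tail d := by
  by_contra! hc
  apply mem_support_iff.mp he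
  rw [dh, coeff_sum]
  refine Finset.sum_eq_zero fun d hd => ?_
  rw [coeff_monomial, if_neg]
  exact fun h => hc d hd h.symm

lemma dh_aeval {P : MvPolynomial (Fin 4) ℝ} {D : ℕ} (hP : IsWeightedHomogeneous dg P (2 * D))
    {A : Type*} [CommRing A] [Algebra ℝ A] (x u Y Z T : A) (hxu : x * u = 1) :
    aeval ![x, Y, Z, T] P = x ^ D * aeval ![Y * u ^ 6, Z * u ^ 10, T * u ^ 15] (dh P) := by
  rw [dh, map_sum, Finset.mul_sum]
  conv_lhs => rw [P.as_sum, map_sum]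
  refine Finset.sum_congr rfl fun d hd => ?_
  have h := wt_dg hP hd
  rw [aeval_monomial, aeval_monomial, Finsupp.prod_fintype _ _ (by simp),
    Finsupp.prod_fintype _ _ (by simp), Fin.prod_univ_four, Fin.prod_univ_three]
  have e1 : Finsupp.tail d 0 = d 1 := rfl
  have e2 : Finsupp.tail d 1 = d 2 := rfl
  have e3 : Finsupp.tail d 2 = d 3 := rfl
  rw [e1, e2, e3]
  have hD : D = d 0 + (6 * d 1 + 10 * d 2 + 15 * d 3) := by omega
  have hx : x ^ D * u ^ (6 * d 1 + 10 * d 2 + 15 * d 3) = x ^ d 0 := by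
    rw [hD, pow_add, mul_assoc, ← mul_pow, hxu, one_pow, mul_one]
  change _ * (x ^ d 0 * Y ^ d 1 * Z ^ d 2 * T ^ d 3) =
    _ * (_ * ((Y * u ^ 6) ^ d 1 * (Z * u ^ 10) ^ d 2 * (T * u ^ 15) ^ d 3))
  rw [← hx]
  simp only [mul_pow, ← pow_mul, pow_add]
  ring

lemma main_inv (D m : ℕ) (G : MvPolynomial (Fin 4) ℝ) (hG : G ≠ 0)
    (Q : MvPolynomial (Fin 4) ℝ) (hQ : IsWeightedHomogeneous dg Q (2 * D)) (hQG : aeval kk Q = G)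
    (hv : PowerSeries.X ^ m ∣ tht G) : 9 * m ≤ 5 * D := by
  obtain ⟨y, b, a, hy, hb, ha, hy0, hb0, ha0⟩ := exp_all
  have hQ0 : Q ≠ 0 := by rintro rfl; exact hG (by rw [← hQG, map_zero])
  have hx0 : PowerSeries.constantCoeff (tht xq) = ((1 : R3ˣ) : R3) := by
    rw [tht_xq]; simp
  set u := PowerSeries.invOfUnit (tht xq) 1 with hu
  have hxu : tht xq * u = 1 := PowerSeries.mul_invOfUnit _ _ hx0
  have hu0 : PowerSeries.constantCoeff u = 1 := by
    have := congrArg PowerSeries.constantCoeff hxu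
    rw [map_mul, hx0, map_one] at this
    simpa using this
  have hG1 : tht G = aeval ![tht xq, tht YY, tht ZZ, tht TT] Q := by
    have : tht.comp (aeval kk) = aeval ![tht xq, tht YY, tht ZZ, tht TT] := by
      refine MvPolynomial.algHom_ext fun i => ?_
      rw [AlgHom.comp_apply, aeval_X, aeval_X]
      fin_cases i <;> rfl
    rw [← hQG, ← this]; rfl
  rw [dh_aeval hQ _ u _ _ _ hxu] at hG1
  set h2 : PowerSeries R3 := PowerSeries.C (C (1 / 2)) with hh2
  have h22 : h2 * 2 = 1 := by
    rw [hh2, ← map_ofNat PowerSeries.C 2, ← map_mul, ← map_ofNat C 2, ← C_mul]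
    norm_num
  have hG2 : aeval ![tht YY * u ^ 6, tht ZZ * u ^ 10, tht TT * u ^ 15] (dh Q) =
      aeval ![PowerSeries.X ^ 2 * (y * u ^ 6), PowerSeries.X ^ 6 * (b * u ^ 12),
        PowerSeries.X ^ 10 * (h2 * a * u ^ 18)] (tau3 (dh Q)) := by
    have : (aeval ![PowerSeries.X ^ 2 * (y * u ^ 6), PowerSeries.X ^ 6 * (b * u ^ 12),
        PowerSeries.X ^ 10 * (h2 * a * u ^ 18)]).comp tau3 =
        aeval ![tht YY * u ^ 6, tht ZZ * u ^ 10, tht TT * u ^ 15] := by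
      have p12 : tht xq ^ 2 * u ^ 12 = u ^ 10 := by
        calc _ = (tht xq * u) ^ 2 * u ^ 10 := by ring
          _ = _ := by rw [hxu]; ring
      have p18 : tht xq ^ 3 * u ^ 18 = u ^ 15 := by
        calc _ = (tht xq * u) ^ 3 * u ^ 15 := by ring
          _ = _ := by rw [hxu]; ring
      have p182 : tht xq ^ 2 * u ^ 18 = u ^ 16 := by
        calc _ = (tht xq * u) ^ 2 * u ^ 16 := by ring
          _ = _ := by rw [hxu]; ring
      have h32 : PowerSeries.C (C (3 / 2)) = 3 * h2 := by
        rw [hh2, ← map_ofNat PowerSeries.C 3, ← map_mul, ← map_ofNat C 3, ← C_mul]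
        norm_num
      refine MvPolynomial.algHom_ext fun i => ?_
      rw [AlgHom.comp_apply, tau3, aeval_X, aeval_X]
      fin_cases i
      · simp [hy]; ring
      · simp
        linear_combination (-u ^ 12) * hb + tht ZZ * p12 - u ^ 12 *
          (tht YY + PowerSeries.X ^ 2 * y) * hy
      · simp [amap, h32]
        have e1 : PowerSeries.X ^ 2 * (y * u ^ 6) = tht YY * u ^ 6 := by rw [hy]; ring
        have e2 : PowerSeries.X ^ 6 * (b * u ^ 12) =
            (tht ZZ * tht xq ^ 2 - tht YY ^ 2) * u ^ 12 := by rw [hb]; ring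
        have e3 : PowerSeries.X ^ 10 * (h2 * a * u ^ 18) =
            h2 * (2 * (tht TT * tht xq ^ 3) + tht YY ^ 3 - 3 * tht YY * (tht ZZ * tht xq ^ 2))
              * u ^ 18 := by rw [ha]; ring
        rw [e1, e2, e3]
        linear_combination (tht TT * tht xq ^ 3 * u ^ 18 - tht YY ^ 3 * u ^ 18) * h22 +
          tht TT * p18
    rw [← this]; rfl
  have hv2 : PowerSeries.X ^ m ∣ aeval ![PowerSeries.X ^ 2 * (y * u ^ 6),
      PowerSeries.X ^ 6 * (b * u ^ 12), PowerSeries.X ^ 10 * (h2 * a * u ^ 18)] (tau3 (dh Q)) := by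
    rw [← hG2]
    have := hv.mul_left (u ^ D)
    rwa [hG1, ← mul_assoc, ← mul_pow, mul_comm u, hxu, one_pow, one_mul] at this
  have hind : ∀ P : R3, aeval ![PowerSeries.constantCoeff (y * u ^ 6),
      PowerSeries.constantCoeff (b * u ^ 12), PowerSeries.constantCoeff (h2 * a * u ^ 18)] P = 0 →
      P = 0 := by
    intro P hP
    apply ff_indep
    rw [← hP]
    congr 2
    simp only [map_mul, map_pow, hu0, one_pow, mul_one, hy0, hb0, ha0, hh2,
      PowerSeries.constantCoeff_C]
    rfl
  have hl := local_order _ _ _ hind _ _ hv2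
  have := end3 D ((m + 1) / 2) (dh Q) (dh_ne hQ hQ0) (by
    intro e he
    obtain ⟨d, hd, rfl⟩ := dh_supp Q he
    have := wt_dg hQ hd
    change 6 * d 1 + 10 * d 2 + 15 * d 3 ≤ D
    omega) (by
    intro e he
    have := hl e he
    omega)
  omega

theorem fin_bound (m : ℕ) (d : ℕ)
    (F : MvPolynomial (Fin 4) ℝ) (hF : F ≠ 0) (hhom : F.IsHomogeneous d)
    (hvan : ∀ v ∈ H4Config, vanishesToOrderR F v m) : 18 * m ≤ 5 * d := by
  obtain ⟨Q, hQ, hQG⟩ := gen Pt (by simp) Pt_norm Pt_pr hgen hgen_hom hgen_sg hgen_det kk ee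
    ee_wh kk_ee _ (NN F) (NN_hom hhom) (NN_sg F)
  have hQ0 : Q ≠ 0 := by rintro rfl; exact NN_ne hF (by rw [← hQG, map_zero])
  obtain ⟨e, he⟩ := Finset.nonempty_iff_ne_empty.mpr (fun h' => hQ0 (support_eq_empty.mp h'))
  have hw := wt_dg hQ he
  obtain ⟨D, hD⟩ : ∃ D, Kf.card * d = 2 * D := ⟨e 0 + 6 * e 1 + 10 * e 2 + 15 * e 3, by omega⟩
  rw [hD] at hQ
  have h1 := main_inv D _ (NN F) (NN_ne hF) Q hQ hQG (NN_van hhom hvan)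
  have h2 : Kf.card * (18 * m) ≤ Kf.card * (5 * d) := by
    calc Kf.card * (18 * m) = 2 * (9 * (Kf.card * m)) := by ring
      _ ≤ 2 * (5 * D) := by omega
      _ = 5 * (Kf.card * d) := by rw [hD]; ring
      _ = _ := by ring
  exact Nat.le_of_mul_le_mul_left h2 Kf_pos

/-- Every nonzero homogeneous polynomial of degree `d` vanishing to order at least `m ≥ 1`
at each of the 60 points of the H4 configuration satisfies `5d ≥ 18m`. -/
theorem H4_degree_lower_bound (m : ℕ) (hm : 1 ≤ m) (d : ℕ)
    (F : MvPolynomial (Fin 4) ℝ) (hF : F ≠ 0) (hhom : F.IsHomogeneous d)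
    (hvan : ∀ v ∈ H4Config, vanishesToOrderR F v m) :
    18 * m ≤ 5 * d := by
  exact fin_bound m d F hF hhom hvan
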